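/- arXiv:2605.30378 — 6 statements merged into one kernel-verified Lean document; each statement's English description precedes it below -/
import Mathlib

section
/- Let Φ(x) = 2(1 − 1/x)^{x−1} Γ(1/2 + x/2) Γ(x) / (Γ(1 + x/2) Γ(−1/2 + x)) for real x > 1. Let κ = 1 + 1/√12 and R(s) = (1/24) · s² / (κ(κ + s)(2κ + s)). Then for every real s with s > −1 and s ≠ 0, the strict inequality log Φ(s + 2) > R(s) holds. -/
noncomputable def Phi (x : ℝ) : ℝ :=
  2 * (1 - 1 / x) ^ (x - 1) * (Real.Gamma (1/2 + x/2) * Real.Gamma x) /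
    (Real.Gamma (1 + x/2) * Real.Gamma (-1/2 + x))

noncomputable def kappa : ℝ := 1 + 1 / Real.sqrt 12

noncomputable def R (s : ℝ) : ℝ :=
  (1/24) * s ^ 2 / (kappa * (kappa + s) * (2 * kappa + s))

open Real Set Filter Topology

/-- The logarithm of the Gamma ratio `Γ((u + 1) / 2) / Γ(u / 2)`. -/
noncomputable def logGammaRatio (u : ℝ) : ℝ :=
  log (Gamma ((u + 1) / 2)) - log (Gamma (u / 2))

lemma log_Gamma_add_one {x : ℝ} (hx : 0 < x) :
    log (Gamma (x + 1)) = log x + log (Gamma x) := by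
  rw [Gamma_add_one hx.ne', log_mul hx.ne' (Gamma_pos_of_pos hx).ne']

lemma logGammaRatio_add_two {u : ℝ} (hu : 0 < u) :
    logGammaRatio (u + 2) = logGammaRatio u - log u + log (u + 1) := by
  unfold logGammaRatio
  have h1 := log_Gamma_add_one (x := u / 2) (by linarith)
  have h2 := log_Gamma_add_one (x := (u + 1) / 2) (by linarith)
  rw [show (u + 2 + 1) / 2 = (u + 1) / 2 + 1 by ring, show (u + 2) / 2 = u / 2 + 1 by ring,
    h1, h2, log_div hu.ne' two_ne_zero, log_div (by linarith) two_ne_zero]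
  ring

lemma two_mul_log_Gamma_add_half_le {x : ℝ} (hx : 0 < x) :
    2 * log (Gamma (x + 1 / 2)) ≤ log (Gamma x) + log (Gamma (x + 1)) := by
  have h := convexOn_log_Gamma.2 (mem_Ioi.2 hx) (mem_Ioi.2 (show 0 < x + 1 by linarith))
    (show (0 : ℝ) ≤ 1 / 2 by norm_num) (show (0 : ℝ) ≤ 1 / 2 by norm_num) (by norm_num)
  simp only [smul_eq_mul, Function.comp_apply] at h
  rw [show 1 / 2 * x + 1 / 2 * (x + 1) = x + 1 / 2 by ring] at h
  linarith

lemma logGammaRatio_le {u : ℝ} (hu : 0 < u) : logGammaRatio u ≤ log (u / 2) / 2 := by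
  unfold logGammaRatio
  have h1 := two_mul_log_Gamma_add_half_le (x := u / 2) (by linarith)
  rw [log_Gamma_add_one (by linarith), show u / 2 + 1 / 2 = (u + 1) / 2 by ring] at h1
  linarith

lemma le_logGammaRatio {u : ℝ} (hu : 1 < u) : log ((u - 1) / 2) / 2 ≤ logGammaRatio u := by
  unfold logGammaRatio
  have h1 := two_mul_log_Gamma_add_half_le (x := (u - 1) / 2) (by linarith)
  have h2 := log_Gamma_add_one (x := (u - 1) / 2) (by linarith)
  rw [show (u - 1) / 2 + 1 = (u + 1) / 2 by ring] at h1 h2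
  rw [show (u - 1) / 2 + 1 / 2 = u / 2 by ring] at h1
  linarith

lemma tendsto_logGammaRatio_sub :
    Tendsto (fun u ↦ logGammaRatio u - log u / 2) atTop (𝓝 (-log 2 / 2)) := by
  have h : Tendsto (fun u : ℝ ↦ log (1 - u⁻¹) / 2 - log 2 / 2) atTop (𝓝 (-log 2 / 2)) := by
    have h0 : Tendsto (fun u : ℝ ↦ 1 - u⁻¹) atTop (𝓝 1) := by
      simpa using tendsto_inv_atTop_zero.const_sub (1 : ℝ)
    have h1 := ((h0.log one_ne_zero).div_const 2).sub_const (log 2 / 2)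
    rw [log_one, zero_div, zero_sub, ← neg_div] at h1
    exact h1
  refine tendsto_of_tendsto_of_tendsto_of_le_of_le' h tendsto_const_nhds ?_ ?_
  · filter_upwards [eventually_gt_atTop 1] with u hu
    have h2 := le_logGammaRatio hu
    have h3 : log ((u - 1) / 2) = log (1 - u⁻¹) + log u - log 2 := by
      rw [log_div (by linarith) two_ne_zero, ← log_mul _ (by linarith)]
      · congr 2
        field_simp
      · exact (sub_pos.2 (inv_lt_one_of_one_lt₀ hu)).ne'
    linarith
  · filter_upwards [eventually_gt_atTop 0] with u hu
    have h2 := logGammaRatio_le hu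
    rw [log_div hu.ne' two_ne_zero] at h2
    linarith

lemma hasDerivAt_logGammaRatio_one : HasDerivAt logGammaRatio (log 2) 1 := by
  have e1 : HasDerivAt (fun u : ℝ ↦ (u + 1) / 2) (1 / 2) 1 :=
    ((hasDerivAt_id' 1).add_const 1).div_const 2
  have e2 : HasDerivAt (fun u : ℝ ↦ u / 2) (1 / 2) 1 := (hasDerivAt_id' 1).div_const 2
  have g1 : HasDerivAt Gamma (-eulerMascheroniConstant) ((1 + 1) / 2) := by
    norm_num [hasDerivAt_Gamma_one]
  have d1 := (g1.comp 1 e1).log (by norm_num)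
  have g2 : HasDerivAt Gamma _ (1 / 2) := hasDerivAt_Gamma_one_half
  have d2 := (g2.comp 1 e2).log (by
    rw [Function.comp_apply, Gamma_one_half_eq]
    positivity)
  refine (d1.sub d2).congr_deriv ?_
  have hpi : √π ≠ 0 := (sqrt_pos.2 pi_pos).ne'
  simp only [Function.comp_apply, Gamma_one_half_eq]
  norm_num
  field_simp
  ring

lemma hasDerivAt_logGammaRatio_add_two {u d : ℝ} (hu : 0 < u)
    (h : HasDerivAt logGammaRatio d u) :
    HasDerivAt logGammaRatio (d - 1 / u + 1 / (u + 1)) (u + 2) := by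
  have h1 : HasDerivAt (fun v ↦ logGammaRatio v - log v + log (v + 1))
      (d - 1 / u + 1 / (u + 1)) u :=
    (h.sub ((hasDerivAt_id' u).log hu.ne')).add
      (((hasDerivAt_id' u).add_const 1).log (by linarith))
  have h2 : HasDerivAt (fun v ↦ logGammaRatio (v + 2)) (d - 1 / u + 1 / (u + 1)) u := by
    refine h1.congr_of_eventuallyEq ?_
    filter_upwards [eventually_gt_nhds hu] with v hv using logGammaRatio_add_two hv
  rw [← add_sub_cancel_right u 2] at h2
  simpa using h2.comp_sub_const (u + 2) 2

lemma hasDerivAt_logGammaRatio_five : HasDerivAt logGammaRatio (log 2 - 7 / 12) 5 := by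
  have h3 := hasDerivAt_logGammaRatio_add_two one_pos hasDerivAt_logGammaRatio_one
  rw [show (1 + 2 : ℝ) = 3 by norm_num] at h3
  have h5 := hasDerivAt_logGammaRatio_add_two (by norm_num) h3
  rw [show (3 + 2 : ℝ) = 5 by norm_num] at h5
  exact h5.congr_deriv (by norm_num; ring)

lemma tendsto_add_two_mul (u : ℝ) : Tendsto (fun k : ℕ ↦ u + 2 * (k : ℝ)) atTop atTop :=
  tendsto_atTop_add_const_left _ _
    (tendsto_natCast_atTop_atTop.const_mul_atTop two_pos)

/-- A function with convex two-step differences and a limit at infinity is convex. -/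
lemma convexOn_of_convexOn_sub_add_two {f : ℝ → ℝ} {a l : ℝ}
    (hg : ConvexOn ℝ (Ioi a) fun u ↦ f u - f (u + 2)) (hf : Tendsto f atTop (𝓝 l)) :
    ConvexOn ℝ (Ioi a) f := by
  refine ⟨convex_Ioi a, fun x hx y hy p q hp hq hpq ↦ ?_⟩
  simp only [smul_eq_mul, mem_Ioi] at *
  have hlim : ∀ u : ℝ, Tendsto (fun k : ℕ ↦ f (u + 2 * k)) atTop (𝓝 l) := fun u ↦
    hf.comp (tendsto_add_two_mul u)
  have hanti : Antitone fun k : ℕ ↦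
      p * f (x + 2 * k) + q * f (y + 2 * k) - f (p * x + q * y + 2 * k) := by
    refine antitone_nat_of_succ_le fun k ↦ ?_
    have hk : (0 : ℝ) ≤ k := k.cast_nonneg
    have h := hg.2 (mem_Ioi.2 (show a < x + 2 * k by linarith))
      (mem_Ioi.2 (show a < y + 2 * k by linarith)) hp hq hpq
    have hs : p * (x + 2 * k) + q * (y + 2 * k) = p * x + q * y + 2 * k := by
      linear_combination (2 * (k : ℝ)) * hpq
    simp only [smul_eq_mul, hs] at h
    have e : ∀ u : ℝ, u + 2 * ((k + 1 : ℕ) : ℝ) = u + 2 * k + 2 := fun u ↦ by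
      push_cast; ring
    simp only [e]
    linarith
  have h := hanti.le_of_tendsto
    ((((hlim x).const_mul p).add ((hlim y).const_mul q)).sub (hlim (p * x + q * y))) 0
  have hl : p * l + q * l - l = 0 := by linear_combination l * hpq
  simp only [hl, Nat.cast_zero, mul_zero, add_zero] at h
  linarith

/-- A function with monotone two-step differences and a limit at infinity is monotone. -/
lemma monotoneOn_of_monotoneOn_sub_add_two {f : ℝ → ℝ} {a l : ℝ}
    (hg : MonotoneOn (fun u ↦ f u - f (u + 2)) (Ioi a)) (hf : Tendsto f atTop (𝓝 l)) :
    MonotoneOn f (Ioi a) := by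
  intro x hx y hy hxy
  simp only [mem_Ioi] at hx hy
  have hlim : ∀ u : ℝ, Tendsto (fun k : ℕ ↦ f (u + 2 * k)) atTop (𝓝 l) := fun u ↦
    hf.comp (tendsto_add_two_mul u)
  have hanti : Antitone fun k : ℕ ↦ f (y + 2 * k) - f (x + 2 * k) := by
    refine antitone_nat_of_succ_le fun k ↦ ?_
    have hk : (0 : ℝ) ≤ k := k.cast_nonneg
    have h := hg (mem_Ioi.2 (show a < x + 2 * k by linarith))
      (mem_Ioi.2 (show a < y + 2 * k by linarith)) (by linarith)
    have e : ∀ u : ℝ, u + 2 * ((k + 1 : ℕ) : ℝ) = u + 2 * k + 2 := fun u ↦ by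
      push_cast; ring
    simp only [e]
    simp only at h
    linarith
  have h := hanti.le_of_tendsto ((hlim y).sub (hlim x)) 0
  simp only [sub_self, Nat.cast_zero, mul_zero, add_zero] at h
  linarith

lemma tendsto_logGammaRatio_sub_log_linear :
    Tendsto (fun u ↦ logGammaRatio u - log (2 * u - 1) / 2) atTop (𝓝 (-log 2)) := by
  have h0 : Tendsto (fun u : ℝ ↦ 2 - u⁻¹) atTop (𝓝 2) := by
    simpa using tendsto_inv_atTop_zero.const_sub (2 : ℝ)
  have h1 := tendsto_logGammaRatio_sub.sub ((h0.log two_ne_zero).div_const 2)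
  rw [show -log 2 / 2 - log 2 / 2 = -log 2 by ring] at h1
  refine h1.congr' ?_
  filter_upwards [eventually_gt_atTop 1] with u hu
  have h2 : 0 < 2 - u⁻¹ := by linarith [inv_lt_one_of_one_lt₀ hu]
  rw [show 2 * u - 1 = u * (2 - u⁻¹) by field_simp, log_mul (by linarith) h2.ne']
  ring

lemma tendsto_logGammaRatio_sub_log_quadratic :
    Tendsto (fun u ↦ logGammaRatio u - log (u ^ 2 - u + 1 / 2) / 4) atTop
      (𝓝 (-log 2 / 2)) := by
  have h0 : Tendsto (fun u : ℝ ↦ 1 - u⁻¹ + u⁻¹ ^ 2 / 2) atTop (𝓝 1) := by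
    simpa using (tendsto_inv_atTop_zero.const_sub (1 : ℝ)).add
      ((tendsto_inv_atTop_zero (𝕜 := ℝ).pow 2).div_const 2)
  have h1 := tendsto_logGammaRatio_sub.sub ((h0.log one_ne_zero).div_const 4)
  rw [log_one, zero_div, sub_zero] at h1
  refine h1.congr' ?_
  filter_upwards [eventually_gt_atTop 1] with u hu
  have h2 : 0 < 1 - u⁻¹ + u⁻¹ ^ 2 / 2 := by
    have := inv_lt_one_of_one_lt₀ hu
    positivity [sub_pos.2 this]
  rw [show u ^ 2 - u + 1 / 2 = u ^ 2 * (1 - u⁻¹ + u⁻¹ ^ 2 / 2) by field_simp,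
    log_mul (by positivity) h2.ne', log_pow]
  push_cast
  ring

lemma convexOn_logGammaRatio_sub_log_linear :
    ConvexOn ℝ (Ioi 1) fun u ↦ logGammaRatio u - log (2 * u - 1) / 2 := by
  refine convexOn_of_convexOn_sub_add_two ?_ tendsto_logGammaRatio_sub_log_linear
  have hd : ∀ u ∈ Ioi (1 : ℝ), HasDerivAt
      (fun u ↦ log u - log (u + 1) - log (2 * u - 1) / 2 + log (2 * u + 3) / 2)
      (-(3 / 4) / ((u ^ 2 + u) * (u ^ 2 + u - 3 / 4))) u := by
    intro u hu
    simp only [mem_Ioi] at hu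
    have h1 := (hasDerivAt_id' u).log (by linarith)
    have h2 := ((hasDerivAt_id' u).add_const 1).log (by linarith)
    have h3 := ((((hasDerivAt_id' u).const_mul 2).sub_const 1).log (by linarith)).div_const 2
    have h4 := ((((hasDerivAt_id' u).const_mul 2).add_const 3).log (by linarith)).div_const 2
    refine (((h1.sub h2).sub h3).add h4).congr_deriv ?_
    have e1 : u + 1 ≠ 0 := by linarith
    have e2 : u * 2 - 1 ≠ 0 := by linarith
    have e3 : 2 * u + 3 ≠ 0 := by linarith
    have e4 : u ≠ 0 := by linarith
    rw [show (u ^ 2 + u) * (u ^ 2 + u - 3 / 4) =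
      u * (u + 1) * ((u * 2 - 1) * (2 * u + 3)) / 4 by ring, mul_comm 2 u]
    field_simp
    ring
  have hc : ConvexOn ℝ (Ioi 1)
      (fun u : ℝ ↦ log u - log (u + 1) - log (2 * u - 1) / 2 + log (2 * u + 3) / 2) := by
    refine MonotoneOn.convexOn_of_deriv (convex_Ioi 1)
      (fun u hu ↦ (hd u hu).continuousAt.continuousWithinAt)
      (fun u hu ↦ (hd u (interior_subset hu)).differentiableAt.differentiableWithinAt) ?_
    rw [interior_Ioi]
    intro x hx y hy hxy
    rw [(hd x hx).deriv, (hd y hy).deriv, neg_div, neg_div]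
    simp only [mem_Ioi] at hx hy
    have hx2 : 0 < x ^ 2 + x - 3 / 4 := by nlinarith
    gcongr
  refine hc.congr fun u hu ↦ ?_
  simp only [mem_Ioi] at hu
  simp only
  rw [logGammaRatio_add_two (by linarith), show 2 * (u + 2) - 1 = 2 * u + 3 by ring]
  ring

lemma monotoneOn_logGammaRatio_sub_log_quadratic :
    MonotoneOn (fun u ↦ logGammaRatio u - log (u ^ 2 - u + 1 / 2) / 4) (Ioi 1) := by
  refine monotoneOn_of_monotoneOn_sub_add_two ?_ tendsto_logGammaRatio_sub_log_quadratic
  have hd : ∀ u ∈ Ioi (1 : ℝ), HasDerivAt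
      (fun u ↦ log u - log (u + 1) - log (u ^ 2 - u + 1 / 2) / 4
        + log (u ^ 2 + 3 * u + 5 / 2) / 4)
      ((5 / 4) / ((u ^ 2 + u) * ((u ^ 2 - u + 1 / 2) * (u ^ 2 + 3 * u + 5 / 2)))) u := by
    intro u hu
    simp only [mem_Ioi] at hu
    have e1 : u + 1 ≠ 0 := by linarith
    have e2 : u ^ 2 - u + 1 / 2 ≠ 0 := by nlinarith
    have e3 : u ^ 2 + 3 * u + 5 / 2 ≠ 0 := by positivity
    have e4 : u ≠ 0 := by linarith
    have h1 := (hasDerivAt_id' u).log e4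
    have h2 := ((hasDerivAt_id' u).add_const 1).log e1
    have h3 := ((((hasDerivAt_pow 2 u).sub (hasDerivAt_id' u)).add_const (1 / 2)).log
      e2).div_const 4
    have h4 := ((((hasDerivAt_pow 2 u).add ((hasDerivAt_id' u).const_mul 3)).add_const
      (5 / 2)).log e3).div_const 4
    refine (((h1.sub h2).sub h3).add h4).congr_deriv ?_
    simp only [Pi.sub_apply, Pi.add_apply]
    rw [show u ^ 2 + u = u * (u + 1) by ring]
    have e2' : u ^ 2 * 2 - u * 2 + 1 ≠ 0 := by nlinarith
    field_simp
    ring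
  have hm : MonotoneOn (fun u : ℝ ↦ log u - log (u + 1) - log (u ^ 2 - u + 1 / 2) / 4
        + log (u ^ 2 + 3 * u + 5 / 2) / 4) (Ioi 1) := by
    refine monotoneOn_of_deriv_nonneg (convex_Ioi 1)
      (fun u hu ↦ (hd u hu).continuousAt.continuousWithinAt)
      (fun u hu ↦ (hd u (interior_subset hu)).differentiableAt.differentiableWithinAt) ?_
    rw [interior_Ioi]
    intro u hu
    rw [(hd u hu).deriv]
    simp only [mem_Ioi] at hu
    have e2 : 0 < u ^ 2 - u + 1 / 2 := by nlinarith
    positivity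
  refine hm.congr fun u hu ↦ ?_
  simp only [mem_Ioi] at hu
  simp only
  rw [logGammaRatio_add_two (by linarith),
    show (u + 2) ^ 2 - (u + 2) + 1 / 2 = u ^ 2 + 3 * u + 5 / 2 by ring]
  ring

lemma log_le_pade {w : ℝ} (hw : 0 ≤ w) : log (1 + w) ≤ w * (6 + w) / (6 + 4 * w) := by
  have hd : ∀ x ∈ Ici (0 : ℝ), HasDerivAt
      (fun x ↦ x * (6 + x) / (6 + 4 * x) - log (1 + x))
      (4 * x ^ 3 / ((6 + 4 * x) ^ 2 * (1 + x))) x := by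
    intro x hx
    simp only [mem_Ici] at hx
    have e1 : 1 + x ≠ 0 := by positivity
    have e2 : 6 + 4 * x ≠ 0 := by positivity
    have h1 := (hasDerivAt_id' x).mul ((hasDerivAt_id' x).const_add 6)
    have h2 := ((hasDerivAt_id' x).const_mul 4).const_add 6
    refine ((h1.div h2 e2).sub (((hasDerivAt_id' x).const_add 1).log e1)).congr_deriv ?_
    simp only [Pi.mul_apply]
    field_simp
    ring
  have hm := monotoneOn_of_deriv_nonneg (convex_Ici 0)
    (fun x hx ↦ (hd x hx).continuousAt.continuousWithinAt)
    (fun x hx ↦ (hd x (interior_subset hx)).differentiableAt.differentiableWithinAt)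
    (fun x hx ↦ by
      have hx' := interior_subset hx
      rw [(hd x hx').deriv]
      simp only [mem_Ici] at hx'
      positivity)
  have h := hm (mem_Ici.2 le_rfl) (mem_Ici.2 hw) hw
  simp only [zero_mul, zero_div, add_zero, log_one, sub_zero] at h
  linarith

lemma log_Phi_add_two {s : ℝ} (hs : -1 < s) :
    log (Phi (s + 2)) = log 2 + (s + 1) * (log (s + 1) - log (s + 2)) +
      (logGammaRatio (3 + 2 * s) - logGammaRatio (3 + s)) := by
  unfold Phi logGammaRatio
  have hb : 1 - 1 / (s + 2) = (s + 1) / (s + 2) := by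
    have : s + 2 ≠ 0 := by linarith
    field_simp
    ring
  have hp : 0 < (s + 1) / (s + 2) := div_pos (by linarith) (by linarith)
  rw [hb, show (1 : ℝ) / 2 + (s + 2) / 2 = (3 + s) / 2 by ring,
    show 1 + (s + 2) / 2 = (3 + s + 1) / 2 by ring,
    show -1 / 2 + (s + 2) = (3 + 2 * s) / 2 by ring,
    show (3 + 2 * s + 1) / 2 = s + 2 by ring, show s + 2 - 1 = s + 1 by ring]
  have g1 := Gamma_pos_of_pos (show 0 < (3 + s) / 2 by linarith)
  have g2 := Gamma_pos_of_pos (show 0 < s + 2 by linarith)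
  have g3 := Gamma_pos_of_pos (show 0 < (3 + s + 1) / 2 by linarith)
  have g4 := Gamma_pos_of_pos (show 0 < (3 + 2 * s) / 2 by linarith)
  have hr := rpow_pos_of_pos hp (s + 1)
  rw [log_div (by positivity) (by positivity), log_mul (by positivity) (by positivity),
    log_mul (by positivity) (by positivity), log_mul g1.ne' g2.ne', log_mul g3.ne' g4.ne',
    log_rpow hp, log_div (by linarith) (by linarith)]
  ring

lemma five_fourths_le_kappa : 5 / 4 ≤ kappa := by
  have h0 : (0 : ℝ) < √12 := by positivity
  have h : √12 ≤ 4 := sqrt_le_iff.2 ⟨by norm_num, by norm_num⟩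
  have := one_div_le_one_div_of_le h0 h
  unfold kappa
  linarith

/-- Replacing `kappa` by `5 / 4` in `R`, in partial fractions. -/
lemma R_le {s : ℝ} (hs : -1 < s) :
    R s ≤ 1 / 30 + 1 / 6 / (4 * s + 5) - 1 / 3 / (2 * s + 5) := by
  have hk := five_fourths_le_kappa
  have e1 : s * 4 + 5 ≠ 0 := by linarith
  have e2 : s * 2 + 5 ≠ 0 := by linarith
  calc R s ≤ 1 / 24 * s ^ 2 / (5 / 4 * (5 / 4 + s) * (2 * (5 / 4) + s)) := by
        unfold R
        have : 0 < 5 / 4 + s := by linarith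
        have : 0 < 2 * (5 / 4) + s := by linarith
        have : 0 < kappa + s := by linarith
        gcongr
    _ = _ := by
        rw [show 5 / 4 * (5 / 4 + s) * (2 * (5 / 4) + s) =
          5 / 32 * ((4 * s + 5) * (2 * s + 5)) by ring]
        field_simp
        ring

/-- Tangent line comparison at the point `5`, where the derivative is known exactly. -/
lemma le_logGammaRatio_sub_of_tangent {s : ℝ} (hs : -1 < s) :
    log (3 + 2 * s) - log (4 + 2 * s) - log (3 + s) + log (4 + s) + log (9 + 4 * s) / 2
      - log (9 + 2 * s) / 2 + (log 2 - 25 / 36) * s ≤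
    logGammaRatio (3 + 2 * s) - logGammaRatio (3 + s) := by
  set N : ℝ → ℝ := fun u ↦ logGammaRatio u - log (2 * u - 1) / 2 with hN
  have hconv : ConvexOn ℝ (Ioi 1) N := convexOn_logGammaRatio_sub_log_linear
  have hder : HasDerivAt N (log 2 - 25 / 36) 5 := by
    have h1 := ((((hasDerivAt_id' (5 : ℝ)).const_mul 2).sub_const 1).log
      (by norm_num)).div_const 2
    exact (hasDerivAt_logGammaRatio_five.sub h1).congr_deriv (by norm_num; ring)
  have h5 : (5 : ℝ) ∈ Ioi 1 := by norm_num
  have hx : 5 + s ∈ Ioi 1 := mem_Ioi.2 (by linarith)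
  have hy : 5 + 2 * s ∈ Ioi 1 := mem_Ioi.2 (by linarith)
  have htan : N 5 + (log 2 - 25 / 36) * s ≤ N (5 + s) := by
    rcases lt_trichotomy s 0 with h | rfl | h
    · have := hconv.slope_le_of_hasDerivAt hx h5 (by linarith) hder
      rw [slope_def_field, div_le_iff₀ (by linarith)] at this
      linarith
    · simp
    · have := hconv.le_slope_of_hasDerivAt h5 hx (by linarith) hder
      rw [slope_def_field, le_div_iff₀ (by linarith)] at this
      linarith
  have hmid := hconv.2 h5 hy (show (0 : ℝ) ≤ 1 / 2 by norm_num)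
    (show (0 : ℝ) ≤ 1 / 2 by norm_num) (by norm_num)
  simp only [smul_eq_mul] at hmid
  rw [show 1 / 2 * 5 + 1 / 2 * (5 + 2 * s) = 5 + s by ring] at hmid
  have a1 := logGammaRatio_add_two (u := 3 + 2 * s) (by linarith)
  have a2 := logGammaRatio_add_two (u := 3 + s) (by linarith)
  rw [show 3 + 2 * s + 2 = 5 + 2 * s by ring, show 3 + 2 * s + 1 = 4 + 2 * s by ring] at a1
  rw [show 3 + s + 2 = 5 + s by ring, show 3 + s + 1 = 4 + s by ring] at a2
  simp only [hN, show 2 * (5 + 2 * s) - 1 = 9 + 4 * s by ring,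
    show 2 * (5 + s) - 1 = 9 + 2 * s by ring] at htan hmid
  linarith

lemma le_logGammaRatio_sub_of_nonneg {s : ℝ} (hs : 0 ≤ s) :
    log (4 * s ^ 2 + 10 * s + 13 / 2) / 4 - log (s ^ 2 + 5 * s + 13 / 2) / 4 ≤
      logGammaRatio (3 + 2 * s) - logGammaRatio (3 + s) := by
  have h := monotoneOn_logGammaRatio_sub_log_quadratic
    (mem_Ioi.2 (show 1 < 3 + s by linarith)) (mem_Ioi.2 (show 1 < 3 + 2 * s by linarith))
    (by linarith)
  simp only [show (3 + s) ^ 2 - (3 + s) + 1 / 2 = s ^ 2 + 5 * s + 13 / 2 by ring,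
    show (3 + 2 * s) ^ 2 - (3 + 2 * s) + 1 / 2 = 4 * s ^ 2 + 10 * s + 13 / 2 by ring] at h
  linarith

lemma two_mul_div_le_log_mul_self {s : ℝ} (hs : -1 < s) :
    s * (2 * s / (3 * s + 4)) ≤ s * (log 2 + log (s + 1) - log (s + 2)) := by
  have e2 : s + 2 ≠ 0 := by linarith
  have e1 : s + 1 ≠ 0 := by linarith
  have e3 : 3 * s + 4 ≠ 0 := by linarith
  rcases le_total 0 s with h | h
  · have h1 := le_log_one_add_of_nonneg (div_nonneg h (show 0 ≤ s + 2 by linarith))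
    rw [show 1 + s / (s + 2) = 2 * (s + 1) / (s + 2) by field_simp; ring,
      log_div (by positivity) e2, log_mul two_ne_zero e1] at h1
    have e : 2 * (s / (s + 2)) / (s / (s + 2) + 2) = 2 * s / (3 * s + 4) := by
      rw [show s / (s + 2) + 2 = (3 * s + 4) / (s + 2) by field_simp; ring]
      field_simp
    rw [e] at h1
    exact mul_le_mul_of_nonneg_left h1 h
  · have h1 := le_log_one_add_of_nonneg
      (div_nonneg (neg_nonneg.2 h) (show 0 ≤ 2 * (s + 1) by linarith))
    rw [show 1 + -s / (2 * (s + 1)) = (s + 2) / (2 * (s + 1)) by field_simp; ring,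
      log_div e2 (by positivity), log_mul two_ne_zero e1] at h1
    have e : 2 * (-s / (2 * (s + 1))) / (-s / (2 * (s + 1)) + 2) = -(2 * s / (3 * s + 4)) := by
      rw [show -s / (2 * (s + 1)) + 2 = (3 * s + 4) / (2 * (s + 1)) by field_simp; ring]
      field_simp
    rw [e] at h1
    exact mul_le_mul_of_nonpos_left (by linarith) h

/-- Auxiliary polynomial, in Bernstein form on `[-1, 1 / 2]`. -/
noncomputable def bernsteinForm (x y : ℝ) : ℝ :=
  1376 * y ^ 11 + 304328 * x * y ^ 10 + 6300780 * x ^ 2 * y ^ 9 +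
    58064826 * x ^ 3 * y ^ 8 + 306773307 * x ^ 4 * y ^ 7 + 1025098557 * x ^ 5 * y ^ 6 +
    2255920803 * x ^ 6 * y ^ 5 + 3289493361 * x ^ 7 * y ^ 4 + 3097472610 * x ^ 8 * y ^ 3 +
    1753434572 * x ^ 9 * y ^ 2 + 502718360 * x ^ 10 * y + 42319200 * x ^ 11

lemma bernsteinForm_pos {x y : ℝ} (hx : 0 < x) (hy : 0 ≤ y) : 0 < bernsteinForm x y := by
  unfold bernsteinForm
  positivity

lemma near_deriv_identity {s : ℝ} (hs : -1 < s) :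
    2 * s / (3 * s + 4) + 1 / (s + 2) + (2 / (3 + 2 * s) - 1 / (2 + s) - 1 / (3 + s) +
      1 / (4 + s) + 2 / (9 + 4 * s) - 1 / (9 + 2 * s)) - 25 / 36 +
      2 / 3 / (4 * s + 5) ^ 2 - 2 / 3 / (2 * s + 5) ^ 2 =
    s * bernsteinForm (2 * (1 + s)) (1 - 2 * s) / (5668704 *
      ((3 * s + 4) * (3 + 2 * s) * (2 + s) * (4 + 2 * s) * (3 + s) * (4 + s) * (9 + 4 * s)
        * (9 + 2 * s) * (4 * s + 5) ^ 2 * (2 * s + 5) ^ 2)) := by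
  have e1 : s * 3 + 4 ≠ 0 := by linarith
  have e2 : 3 + 2 * s ≠ 0 := by linarith
  have e3 : 2 + s ≠ 0 := by linarith
  have e4 : 3 + s ≠ 0 := by linarith
  have e5 : 4 + s ≠ 0 := by linarith
  have e6 : 9 + s * 4 ≠ 0 := by linarith
  have e7 : 9 + 2 * s ≠ 0 := by linarith
  have e8 : s * 4 + 5 ≠ 0 := by linarith
  have e9 : 2 * s + 5 ≠ 0 := by linarith
  unfold bernsteinForm
  rw [show 4 + 2 * s = 2 * (2 + s) by ring, add_comm s 2]
  field_simp
  ring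

/-- The elementary minorant of `log Φ(s + 2) - R s` used for `s ≤ 1 / 2`. -/
noncomputable def nearGap (s : ℝ) : ℝ :=
  log 2 + (s + 1) * (log (s + 1) - log (s + 2)) +
    (log (3 + 2 * s) - log (4 + 2 * s) - log (3 + s) + log (4 + s) + log (9 + 4 * s) / 2
      - log (9 + 2 * s) / 2 + (log 2 - 25 / 36) * s) -
    (1 / 30 + 1 / 6 / (4 * s + 5) - 1 / 3 / (2 * s + 5))

lemma hasDerivAt_nearGap {s : ℝ} (hs : -1 < s) :
    HasDerivAt nearGap (log 2 + log (s + 1) - log (s + 2) + 1 / (s + 2) +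
      (2 / (3 + 2 * s) - 1 / (2 + s) - 1 / (3 + s) + 1 / (4 + s) + 2 / (9 + 4 * s)
        - 1 / (9 + 2 * s)) - 25 / 36 +
      2 / 3 / (4 * s + 5) ^ 2 - 2 / 3 / (2 * s + 5) ^ 2) s := by
  have linearLeft : ∀ a b : ℝ, HasDerivAt (fun s : ℝ ↦ a + b * s) b s := fun a b ↦ by
    simpa using ((hasDerivAt_id' s).const_mul b).const_add a
  have shiftLeft : ∀ a : ℝ, HasDerivAt (fun s : ℝ ↦ a + s) 1 s := fun a ↦
    (hasDerivAt_id' s).const_add a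
  have shiftRight : ∀ a : ℝ, HasDerivAt (fun s : ℝ ↦ s + a) 1 s := fun a ↦
    (hasDerivAt_id' s).add_const a
  have linearRight : ∀ a b : ℝ, HasDerivAt (fun s : ℝ ↦ b * s + a) b s := fun a b ↦ by
    simpa using ((hasDerivAt_id' s).const_mul b).add_const a
  have h1 := ((shiftRight 1).mul (((shiftRight 1).log (by linarith)).sub
    ((shiftRight 2).log (by linarith)))).const_add (log 2)
  have h2 := (((((((linearLeft 3 2).log (by linarith)).sub ((linearLeft 4 2).log (by linarith))).sub
    ((shiftLeft 3).log (by linarith))).add ((shiftLeft 4).log (by linarith))).add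
    (((linearLeft 9 4).log (by linarith)).div_const 2)).sub
    (((linearLeft 9 2).log (by linarith)).div_const 2)).add
    ((hasDerivAt_id' s).const_mul (log 2 - 25 / 36))
  have e8 : 4 * s + 5 ≠ 0 := by linarith
  have e9 : 2 * s + 5 ≠ 0 := by linarith
  have h3 := (((hasDerivAt_const s (1 / 6 : ℝ)).div (linearRight 5 4) e8).const_add (1 / 30)).sub
    ((hasDerivAt_const s (1 / 3 : ℝ)).div (linearRight 5 2) e9)
  refine ((h1.add h2).sub h3).congr_deriv ?_
  have e1 : s + 1 ≠ 0 := by linarith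
  have e2 : s + 2 ≠ 0 := by linarith
  have i1 : (s + 1) * (1 / (s + 1) - 1 / (s + 2)) = 1 / (s + 2) := by field_simp; ring
  have i2 : 2 / (4 + 2 * s) = 1 / (2 + s) := by
    rw [show 4 + 2 * s = 2 * (2 + s) by ring, div_mul_eq_div_div, div_self two_ne_zero]
  simp only [Pi.sub_apply, i1, i2]
  ring

lemma mul_deriv_nearGap_pos {s : ℝ} (hs : -1 < s) (hs' : s ≤ 1 / 2) (h0 : s ≠ 0) :
    0 < s * deriv nearGap s := by
  rw [(hasDerivAt_nearGap hs).deriv]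
  have h1 := two_mul_div_le_log_mul_self hs
  have hp := bernsteinForm_pos (show 0 < 2 * (1 + s) by linarith)
    (show 0 ≤ 1 - 2 * s by linarith)
  have h3 : 0 < s * (s * bernsteinForm (2 * (1 + s)) (1 - 2 * s) / (5668704 *
      ((3 * s + 4) * (3 + 2 * s) * (2 + s) * (4 + 2 * s) * (3 + s) * (4 + s) * (9 + 4 * s)
        * (9 + 2 * s) * (4 * s + 5) ^ 2 * (2 * s + 5) ^ 2))) := by
    have e1 : 0 < 3 * s + 4 := by linarith
    have e2 : 0 < 3 + 2 * s := by linarith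
    have e3 : 0 < 2 + s := by linarith
    have e4 : 0 < 3 + s := by linarith
    have e5 : 0 < 4 + s := by linarith
    have e6 : 0 < 9 + 4 * s := by linarith
    have e7 : 0 < 9 + 2 * s := by linarith
    have e8 : 0 < 4 * s + 5 := by linarith
    have e9 : 0 < 2 * s + 5 := by linarith
    have e10 : 0 < 4 + 2 * s := by linarith
    rw [mul_div_assoc, ← mul_assoc]
    exact mul_pos (mul_self_pos.2 h0) (div_pos hp (by positivity))
  rw [← near_deriv_identity hs] at h3
  linarith

lemma nearGap_zero : nearGap 0 = 0 := by
  have h4 : log 4 = 2 * log 2 := by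
    rw [show (4 : ℝ) = 2 ^ 2 by norm_num, log_pow]; norm_num
  unfold nearGap
  norm_num [h4]

lemma nearGap_pos {s : ℝ} (hs : -1 < s) (hs' : s ≤ 1 / 2) (h0 : s ≠ 0) : 0 < nearGap s := by
  rcases lt_or_gt_of_ne h0 with h | h
  · have hm : StrictAntiOn nearGap (Icc s 0) := by
      refine strictAntiOn_of_deriv_neg (convex_Icc s 0)
        (fun x hx ↦ (hasDerivAt_nearGap (hs.trans_le hx.1)).continuousAt.continuousWithinAt)
        fun x hx ↦ ?_
      rw [interior_Icc] at hx
      have := mul_deriv_nearGap_pos (hs.trans hx.1) (by linarith [hx.2]) hx.2.ne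
      exact neg_of_mul_pos_right this hx.2.le
    simpa [nearGap_zero] using hm (left_mem_Icc.2 h.le) (right_mem_Icc.2 h.le) h
  · have hm : StrictMonoOn nearGap (Icc 0 s) := by
      refine strictMonoOn_of_deriv_pos (convex_Icc 0 s)
        (fun x hx ↦ (hasDerivAt_nearGap (by linarith [hx.1])).continuousAt.continuousWithinAt)
        fun x hx ↦ ?_
      rw [interior_Icc] at hx
      exact pos_of_mul_pos_right (mul_deriv_nearGap_pos (by linarith [hx.1])
        (by linarith [hx.2]) hx.1.ne') hx.1.le
    simpa [nearGap_zero] using hm (left_mem_Icc.2 h.le) (right_mem_Icc.2 h.le) h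

/-- The elementary minorant of `log Φ(s + 2) - R s` used for `1 / 2 ≤ s`. -/
noncomputable def farGap (s : ℝ) : ℝ :=
  log 2 + (s + 1) * (log (s + 1) - log (s + 2)) +
    (log (4 * s ^ 2 + 10 * s + 13 / 2) / 4 - log (s ^ 2 + 5 * s + 13 / 2) / 4) -
    (1 / 30 + 1 / 6 / (4 * s + 5) - 1 / 3 / (2 * s + 5))

lemma hasDerivAt_farGap {s : ℝ} (hs : 0 ≤ s) :
    HasDerivAt farGap (log (s + 1) - log (s + 2) + 1 / (s + 2) +
      ((8 * s + 10) / (4 * s ^ 2 + 10 * s + 13 / 2) / 4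
        - (2 * s + 5) / (s ^ 2 + 5 * s + 13 / 2) / 4) +
      2 / 3 / (4 * s + 5) ^ 2 - 2 / 3 / (2 * s + 5) ^ 2) s := by
  have shiftRight : ∀ a : ℝ, HasDerivAt (fun s : ℝ ↦ s + a) 1 s := fun a ↦
    (hasDerivAt_id' s).add_const a
  have linearRight : ∀ a b : ℝ, HasDerivAt (fun s : ℝ ↦ b * s + a) b s := fun a b ↦ by
    simpa using ((hasDerivAt_id' s).const_mul b).add_const a
  have q1 : HasDerivAt (fun s : ℝ ↦ 4 * s ^ 2 + 10 * s + 13 / 2) (8 * s + 10) s :=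
    ((((hasDerivAt_pow 2 s).const_mul 4).add
      ((hasDerivAt_id' s).const_mul 10)).add_const (13 / 2)).congr_deriv (by norm_num; ring)
  have q2 : HasDerivAt (fun s : ℝ ↦ s ^ 2 + 5 * s + 13 / 2) (2 * s + 5) s :=
    (((hasDerivAt_pow 2 s).add
      ((hasDerivAt_id' s).const_mul 5)).add_const (13 / 2)).congr_deriv (by norm_num)
  have h1 := ((shiftRight 1).mul (((shiftRight 1).log (by linarith)).sub
    ((shiftRight 2).log (by linarith)))).const_add (log 2)
  have h2 := ((q1.log (by positivity)).div_const 4).sub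
    ((q2.log (by positivity)).div_const 4)
  have e8 : 4 * s + 5 ≠ 0 := by linarith
  have e9 : 2 * s + 5 ≠ 0 := by linarith
  have h3 := (((hasDerivAt_const s (1 / 6 : ℝ)).div (linearRight 5 4) e8).const_add (1 / 30)).sub
    ((hasDerivAt_const s (1 / 3 : ℝ)).div (linearRight 5 2) e9)
  refine ((h1.add h2).sub h3).congr_deriv ?_
  have e1 : s + 1 ≠ 0 := by linarith
  have e2 : s + 2 ≠ 0 := by linarith
  have i1 : (s + 1) * (1 / (s + 1) - 1 / (s + 2)) = 1 / (s + 2) := by field_simp; ring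
  simp only [Pi.sub_apply, i1]
  ring

lemma deriv_farGap_nonneg {s : ℝ} (hs : 1 / 2 ≤ s) : 0 ≤ deriv farGap s := by
  obtain ⟨t, ht, rfl⟩ : ∃ t : ℝ, 0 ≤ t ∧ s = t + 1 / 2 := ⟨s - 1 / 2, by linarith, by ring⟩
  rw [(hasDerivAt_farGap (by linarith)).deriv]
  have h1 := log_le_pade (show 0 ≤ 1 / (t + 3 / 2) by positivity)
  rw [show 1 + 1 / (t + 3 / 2) = (t + 5 / 2) / (t + 3 / 2) by field_simp; ring,
    log_div (by positivity) (by positivity)] at h1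
  have h2 : 0 ≤ -(1 / (t + 3 / 2) * (6 + 1 / (t + 3 / 2)) / (6 + 4 * (1 / (t + 3 / 2)))) +
      1 / (t + 5 / 2) +
      ((8 * (t + 1 / 2) + 10) / (4 * (t + 1 / 2) ^ 2 + 10 * (t + 1 / 2) + 13 / 2) / 4
        - (2 * (t + 1 / 2) + 5) / ((t + 1 / 2) ^ 2 + 5 * (t + 1 / 2) + 13 / 2) / 4) +
      2 / 3 / (4 * (t + 1 / 2) + 5) ^ 2 - 2 / 3 / (2 * (t + 1 / 2) + 5) ^ 2 := by
    have h : -(1 / (t + 3 / 2) * (6 + 1 / (t + 3 / 2)) / (6 + 4 * (1 / (t + 3 / 2)))) +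
      1 / (t + 5 / 2) +
      ((8 * (t + 1 / 2) + 10) / (4 * (t + 1 / 2) ^ 2 + 10 * (t + 1 / 2) + 13 / 2) / 4
        - (2 * (t + 1 / 2) + 5) / ((t + 1 / 2) ^ 2 + 5 * (t + 1 / 2) + 13 / 2) / 4) +
      2 / 3 / (4 * (t + 1 / 2) + 5) ^ 2 - 2 / 3 / (2 * (t + 1 / 2) + 5) ^ 2 =
      (49755 + 2737430 * t + 8561354 * t ^ 2 + 11689168 * t ^ 3 + 8883480 * t ^ 4 +
        4045552 * t ^ 5 + 1102912 * t ^ 6 + 166592 * t ^ 7 + 10752 * t ^ 8) /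
      (3 * ((t + 3 / 2) * (6 * t + 13) * (t + 5 / 2) * (16 * t ^ 2 + 56 * t + 50) *
        (4 * t ^ 2 + 24 * t + 37) * (4 * t + 7) ^ 2 * (2 * t + 6) ^ 2)) := by
      have p : 6 + 4 * (1 / (t + 3 / 2)) = (6 * t + 13) / (t + 3 / 2) := by field_simp; ring
      have a1 : 4 * (t + 1 / 2) ^ 2 + 10 * (t + 1 / 2) + 13 / 2 =
        (16 * t ^ 2 + 56 * t + 50) / 4 := by ring
      have a2 : (t + 1 / 2) ^ 2 + 5 * (t + 1 / 2) + 13 / 2 =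
        (4 * t ^ 2 + 24 * t + 37) / 4 := by ring
      have a3 : 4 * (t + 1 / 2) + 5 = 4 * t + 7 := by ring
      have a4 : 2 * (t + 1 / 2) + 5 = 2 * t + 6 := by ring
      rw [p, a1, a2, a3, a4]
      field_simp
      ring
    rw [h]
    positivity
  rw [show t + 1 / 2 + 1 = t + 3 / 2 by ring, show t + 1 / 2 + 2 = t + 5 / 2 by ring]
  linarith

lemma farGap_half_pos : 0 < farGap (1 / 2) := by
  have h1 : 4 * log 2 + 6 * (log (3 / 2) - log (5 / 2)) + log (25 / 2) - log (37 / 4) =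
      log (4 * 2916 / (3125 * (37 / 10))) := by
    have e : (4 * 2916 / (3125 * (37 / 10)) : ℝ) =
      2 ^ 4 * (3 / 2) ^ 6 * (25 / 2) / ((5 / 2) ^ 6 * (37 / 4)) := by norm_num
    rw [e]
    conv_rhs =>
      rw [log_div (by norm_num) (by norm_num), log_mul (by norm_num) (by norm_num),
        log_mul (by norm_num) (by norm_num), log_mul (by norm_num) (by norm_num),
        log_pow, log_pow, log_pow]
    push_cast
    ring
  have h2 := one_sub_inv_le_log_of_pos (show (0 : ℝ) < 4 * 2916 / (3125 * (37 / 10)) by norm_num)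
  rw [← h1] at h2
  unfold farGap
  norm_num at h2 ⊢
  linarith

lemma farGap_pos {s : ℝ} (hs : 1 / 2 ≤ s) : 0 < farGap s := by
  have hm := monotoneOn_of_deriv_nonneg (convex_Ici (1 / 2 : ℝ)) (f := farGap)
    (fun x hx ↦ (hasDerivAt_farGap
      (by linarith [mem_Ici.1 hx])).continuousAt.continuousWithinAt)
    (fun x hx ↦ (hasDerivAt_farGap
      (by linarith [mem_Ici.1 (interior_subset hx)])).differentiableAt.differentiableWithinAt)
    (fun x hx ↦ deriv_farGap_nonneg (mem_Ici.1 (interior_subset hx)))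
  exact farGap_half_pos.trans_le (hm (mem_Ici.2 le_rfl) (mem_Ici.2 hs) hs)

theorem stmt_0 (s : ℝ) (hs : s > -1) (hs0 : s ≠ 0) :
    Real.log (Phi (s + 2)) > R s := by
  have hR := R_le hs
  rw [log_Phi_add_two hs]
  rcases le_total s (1 / 2) with h | h
  · have h1 := nearGap_pos hs h hs0
    have h2 := le_logGammaRatio_sub_of_tangent hs
    unfold nearGap at h1
    linarith
  · have h1 := farGap_pos h
    have h2 := le_logGammaRatio_sub_of_nonneg (show 0 ≤ s by linarith)
    unfold farGap at h1
    linarith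
end

section
/- For every real s > 0, Σ_{n=0}^{∞} [ 1/(n + 3/2 + s/2) − 1/(n + 3/2 + s) ] < log((1 + s)/(1 + s/2)). -/
lemma strictAntiOn_log_add_one_sub_log_sub_one_div :
    StrictAntiOn (fun x : ℝ => Real.log (x + 1) - Real.log x - 1 / (x + 1 / 2)) (Set.Ioi 0) := by
  have hd : ∀ x : ℝ, 0 < x →
      HasDerivAt (fun x : ℝ => Real.log (x + 1) - Real.log x - 1 / (x + 1 / 2))
        (1 / (x + 1) - 1 / x - (0 * (x + 1 / 2) - 1 * 1) / (x + 1 / 2) ^ 2) x := by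
    intro x hx
    have h1 : HasDerivAt (fun x : ℝ => Real.log (x + 1)) (1 / (x + 1)) x :=
      ((hasDerivAt_id' x).add_const 1).log (by positivity)
    have h2 : HasDerivAt (fun x : ℝ => Real.log x) (1 / x) x :=
      (hasDerivAt_id' x).log hx.ne'
    have h3 : HasDerivAt (fun x : ℝ => 1 / (x + 1 / 2))
        ((0 * (x + 1 / 2) - 1 * 1) / (x + 1 / 2) ^ 2) x :=
      (hasDerivAt_const x (1 : ℝ)).fun_div ((hasDerivAt_id' x).add_const (1 / 2)) (by positivity)
    exact (h1.sub h2).sub h3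
  refine strictAntiOn_of_deriv_neg (convex_Ioi 0)
    (fun x hx => (hd x hx).continuousAt.continuousWithinAt) fun x hx => ?_
  rw [interior_Ioi] at hx
  have hx : 0 < x := hx
  rw [(hd x hx).deriv]
  have : 1 / (x + 1) - 1 / x - (0 * (x + 1 / 2) - 1 * 1) / (x + 1 / 2) ^ 2 =
      -(1 / 4) / (x * (x + 1) * (x + 1 / 2) ^ 2) := by
    field_simp
    ring
  rw [this]
  exact div_neg_of_neg_of_pos (by norm_num) (by positivity)

theorem stmt_6 (s : ℝ) (hs : s > 0) :
    ∑' n : ℕ, (1 / ((n : ℝ) + 3/2 + s/2) - 1 / ((n : ℝ) + 3/2 + s)) <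
      Real.log ((1 + s) / (1 + s / 2)) := by
  set t : ℕ → ℝ := fun n => 1 / ((n : ℝ) + 3/2 + s/2) - 1 / ((n : ℝ) + 3/2 + s) with ht
  set D : ℕ → ℝ := fun n => Real.log (n + 1 + s) - Real.log (n + 1 + s / 2) with hD
  have t_nonneg : ∀ n, 0 ≤ t n := fun n =>
    sub_nonneg.2 (one_div_le_one_div_of_le (by positivity) (by linarith))
  have D_nonneg : ∀ n, 0 ≤ D n := fun n =>
    sub_nonneg.2 (Real.log_le_log (by positivity) (by linarith))
  have step : ∀ n, t n + D (n + 1) < D n := by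
    intro n
    have h := strictAntiOn_log_add_one_sub_log_sub_one_div
      (show (n : ℝ) + 1 + s / 2 ∈ Set.Ioi 0 from Set.mem_Ioi.2 (by positivity))
      (show (n : ℝ) + 1 + s ∈ Set.Ioi 0 from Set.mem_Ioi.2 (by positivity)) (by linarith)
    simp only [ht, hD]
    push_cast
    rw [show (n : ℝ) + 3 / 2 + s / 2 = n + 1 + s / 2 + 1 / 2 by ring,
      show (n : ℝ) + 3 / 2 + s = n + 1 + s + 1 / 2 by ring,
      show (n : ℝ) + 1 + 1 + s / 2 = n + 1 + s / 2 + 1 by ring,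
      show (n : ℝ) + 1 + 1 + s = n + 1 + s + 1 by ring]
    linarith
  have partial_sum : ∀ N, ∑ i ∈ Finset.range (N + 1), t i + D (N + 1) ≤ t 0 + D 1 := by
    intro N
    induction N with
    | zero => simp
    | succ k ih =>
      rw [Finset.sum_range_succ]
      linarith [step (k + 1)]
  have bound : ∑' n, t n ≤ t 0 + D 1 := by
    refine Real.tsum_le_of_sum_range_le t_nonneg fun N => ?_
    have h := partial_sum N
    rw [Finset.sum_range_succ] at h
    linarith [t_nonneg N, D_nonneg (N + 1)]
  have D_zero : D 0 = Real.log ((1 + s) / (1 + s / 2)) := by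
    rw [Real.log_div (by positivity) (by positivity)]
    simp [hD]
  rw [← D_zero]
  exact bound.trans_lt (step 0)
end

section
/- For every real s with −1 < s < 0, Σ_{n=0}^{∞} [ 1/(n + 3/2 + s/2) − 1/(n + 3/2 + s) ] > log((1 + s)/(1 + s/2)). -/
/-- The midpoint-rule error `1 / (t + 1/2) - ∫ u in t..t+1, 1 / u` is strictly increasing in `t`. -/
lemma strictMonoOn_inv_add_half_sub_log :
    StrictMonoOn (fun t : ℝ => 1 / (t + 1/2) - (Real.log (t + 1) - Real.log t)) (Set.Ioi 0) := by
  have hd : ∀ t : ℝ, 0 < t →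
      HasDerivAt (fun t : ℝ => 1 / (t + 1/2) - (Real.log (t + 1) - Real.log t))
        (-1 / (t + 1/2) ^ 2 - (1 / (t + 1) - 1 / t)) t := by
    intro t ht
    have h1 : HasDerivAt (fun t : ℝ => 1 / (t + 1/2)) (-1 / (t + 1/2) ^ 2) t := by
      simpa only [one_div] using ((hasDerivAt_id' t).add_const (1/2 : ℝ)).fun_inv (by simp; positivity)
    have h2 : HasDerivAt (fun t : ℝ => Real.log (t + 1)) (1 / (t + 1)) t :=
      ((hasDerivAt_id' t).add_const (1 : ℝ)).log (by simp; positivity)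
    have h3 : HasDerivAt Real.log (1 / t) t := by
      simpa only [one_div] using Real.hasDerivAt_log ht.ne'
    exact h1.sub (h2.sub h3)
  refine strictMonoOn_of_deriv_pos (convex_Ioi 0)
    (fun t ht => (hd t ht).continuousAt.continuousWithinAt) fun t ht => ?_
  rw [interior_Ioi] at ht
  have ht : 0 < t := ht
  rw [(hd t ht).deriv]
  have : -1 / (t + 1/2) ^ 2 - (1 / (t + 1) - 1 / t)
      = 1 / (4 * (t * (t + 1) * (t + 1/2) ^ 2)) := by
    field_simp
    ring
  rw [this]
  positivity

/-- The telescoping series of differences of a monotone sequence tending to `l`. -/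
lemma Monotone.hasSum_sub_of_tendsto {h : ℕ → ℝ} {l : ℝ} (hm : Monotone h)
    (hl : Filter.Tendsto h Filter.atTop (nhds l)) :
    HasSum (fun n => h (n + 1) - h n) (l - h 0) := by
  rw [hasSum_iff_tendsto_nat_of_nonneg fun n => sub_nonneg.2 (hm n.le_succ)]
  simpa only [Finset.sum_range_sub] using hl.sub_const (h 0)

theorem stmt_7 (s : ℝ) (hs₁ : -1 < s) (hs₂ : s < 0) :
    ∑' n : ℕ, (1 / ((n : ℝ) + 3/2 + s/2) - 1 / ((n : ℝ) + 3/2 + s)) >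
      Real.log ((1 + s) / (1 + s / 2)) := by
  set h : ℕ → ℝ := fun n => Real.log (((n : ℝ) + 1 + s) / ((n : ℝ) + 1 + s / 2)) with hh
  have hy : ∀ n : ℕ, 0 < (n : ℝ) + 1 + s := fun n => by
    have := n.cast_nonneg (α := ℝ)
    linarith
  have hx : ∀ n : ℕ, 0 < (n : ℝ) + 1 + s / 2 := fun n => by linarith [hy n]
  have hm : Monotone h := monotone_nat_of_le_succ fun n => by
    refine Real.log_le_log (div_pos (hy n) (hx n)) ?_
    rw [div_le_div_iff₀ (hx n) (hx (n + 1))]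
    push_cast
    nlinarith
  have hl : Filter.Tendsto h Filter.atTop (nhds 0) := by
    have h1 : Filter.Tendsto (fun n : ℕ => 1 + (s / 2) / ((n : ℝ) + (1 + s / 2)))
        Filter.atTop (nhds (1 + 0)) :=
      ((Filter.tendsto_atTop_add_const_right _ _
        tendsto_natCast_atTop_atTop).const_div_atTop _).const_add 1
    rw [add_zero] at h1
    have h2 := h1.log one_ne_zero
    rw [Real.log_one] at h2
    refine h2.congr fun n => ?_
    have := (hx n).ne'
    rw [← add_assoc, one_add_div this]
    congr 2
    ring
  have hsum := hm.hasSum_sub_of_tendsto hl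
  have hterm : ∀ n : ℕ,
      1 / ((n : ℝ) + 3/2 + s) - 1 / ((n : ℝ) + 3/2 + s/2) < h (n + 1) - h n := fun n => by
    have key := strictMonoOn_inv_add_half_sub_log (hy n) (hx n) (by linarith)
    have e1 : (n : ℝ) + 1 + s + 1/2 = n + 3/2 + s := by ring
    have e2 : (n : ℝ) + 1 + s/2 + 1/2 = n + 3/2 + s/2 := by ring
    have e3 : ((n + 1 : ℕ) : ℝ) + 1 + s = n + 1 + s + 1 := by push_cast; ring
    have e4 : ((n + 1 : ℕ) : ℝ) + 1 + s/2 = n + 1 + s/2 + 1 := by push_cast; ring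
    have l1 := Real.log_div (hy n).ne' (hx n).ne'
    have l2 := Real.log_div (hy (n + 1)).ne' (hx (n + 1)).ne'
    rw [e3, e4] at l2
    simp only [hh, e3, e4, l1, l2]
    simp only [e1, e2] at key
    linarith
  have hnonneg : ∀ n : ℕ, 0 ≤ 1 / ((n : ℝ) + 3/2 + s) - 1 / ((n : ℝ) + 3/2 + s/2) := fun n =>
    sub_nonneg.2 (one_div_le_one_div_of_le (by linarith [hy n]) (by linarith))
  have hlt := (hsum.summable.of_nonneg_of_le hnonneg fun n => (hterm n).le).tsum_lt_tsum
    (i := 0) (fun n => (hterm n).le) (hterm 0) hsum.summable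
  rw [hsum.tsum_eq] at hlt
  have h0 : h 0 = Real.log ((1 + s) / (1 + s / 2)) := by simp [hh]
  have hneg : ∑' n : ℕ, (1 / ((n : ℝ) + 3/2 + s/2) - 1 / ((n : ℝ) + 3/2 + s))
      = -∑' n : ℕ, (1 / ((n : ℝ) + 3/2 + s) - 1 / ((n : ℝ) + 3/2 + s/2)) := by
    rw [← tsum_neg]
    simp only [neg_sub]
  linarith
end

section
/- Let Φ(x) = 2(1 − 1/x)^{x−1} Γ(1/2 + x/2) Γ(x) / (Γ(1 + x/2) Γ(−1/2 + x)) for real x > 1. Then the derivative Φ′(x) is strictly positive for every x > 2, and strictly negative for every x with 1 < x < 2; consequently Φ is strictly decreasing on (1, 2) and strictly increasing on (2, ∞). -/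
open Filter Topology Set

/-- The real digamma function. -/
noncomputable def realDigamma (x : ℝ) : ℝ := deriv Real.Gamma x / Real.Gamma x

/-- The contribution of the Gamma factors to the logarithmic derivative of `Phi`. -/
noncomputable def gammaPart (x : ℝ) : ℝ :=
  realDigamma x - realDigamma (x - 1/2)
    - (realDigamma (1 + x/2) - realDigamma (1/2 + x/2)) / 2

/-- The logarithmic derivative of `Phi`. -/
noncomputable def logDerivPhi (x : ℝ) : ℝ :=
  Real.log (1 - 1/x) + 1/x + gammaPart x

lemma differentiableAt_Gamma_of_pos {x : ℝ} (hx : 0 < x) : DifferentiableAt ℝ Real.Gamma x :=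
  Real.differentiableAt_Gamma fun m => by
    have : (0 : ℝ) ≤ m := m.cast_nonneg
    linarith

lemma hasDerivAt_Gamma_realDigamma {x : ℝ} (hx : 0 < x) :
    HasDerivAt Real.Gamma (Real.Gamma x * realDigamma x) x := by
  have h := (differentiableAt_Gamma_of_pos hx).hasDerivAt
  refine h.congr_deriv ?_
  have := (Real.Gamma_pos_of_pos hx).ne'
  unfold realDigamma
  field_simp

lemma realDigamma_add_one {x : ℝ} (hx : 0 < x) :
    realDigamma (x + 1) = realDigamma x + 1/x := by
  have h1 : HasDerivAt (fun y => Real.Gamma (y + 1))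
      (Real.Gamma (x + 1) * realDigamma (x + 1)) x :=
    (hasDerivAt_Gamma_realDigamma (by linarith : 0 < x + 1)).comp_add_const x 1
  have h2 : HasDerivAt (fun y => y * Real.Gamma y)
      (1 * Real.Gamma x + x * (Real.Gamma x * realDigamma x)) x :=
    (hasDerivAt_id x).mul (hasDerivAt_Gamma_realDigamma hx)
  have he : (fun y => Real.Gamma (y + 1)) =ᶠ[𝓝 x] fun y => y * Real.Gamma y := by
    filter_upwards [lt_mem_nhds hx] with y hy using Real.Gamma_add_one (ne_of_gt hy)
  have h := h1.unique (h2.congr_of_eventuallyEq he)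
  rw [Real.Gamma_add_one hx.ne'] at h
  have hG := (Real.Gamma_pos_of_pos hx).ne'
  have h' : Real.Gamma x * (x * realDigamma (x + 1) - (1 + x * realDigamma x)) = 0 := by
    linear_combination h
  have h'' := (mul_eq_zero.mp h').resolve_left hG
  field_simp
  linarith

lemma realDigamma_monotoneOn : MonotoneOn realDigamma (Ioi 0) := by
  have hd : ∀ x ∈ Ioi (0 : ℝ), HasDerivAt (Real.log ∘ Real.Gamma) (realDigamma x) x :=
    fun x hx => (differentiableAt_Gamma_of_pos hx).hasDerivAt.log (Real.Gamma_pos_of_pos hx).ne'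
  have h := Real.convexOn_log_Gamma.monotoneOn_deriv fun x hx => (hd x hx).differentiableAt
  intro x hx y hy hxy
  have := h hx hy hxy
  rwa [(hd x hx).deriv, (hd y hy).deriv] at this

lemma realDigamma_one : realDigamma 1 = -Real.eulerMascheroniConstant := by
  simp [realDigamma, Real.hasDerivAt_Gamma_one.deriv]

lemma realDigamma_one_half :
    realDigamma (1/2) = -(Real.eulerMascheroniConstant + 2 * Real.log 2) := by
  have : √Real.pi ≠ 0 := by positivity
  rw [realDigamma, Real.hasDerivAt_Gamma_one_half.deriv, Real.Gamma_one_half_eq]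
  field_simp

lemma realDigamma_sub_half_bounds {x : ℝ} (hx : 1/2 < x) :
    0 ≤ realDigamma x - realDigamma (x - 1/2) ∧
      realDigamma x - realDigamma (x - 1/2) ≤ 1 / (x - 1/2) := by
  have h0 : 0 < x - 1/2 := by linarith
  have h1 := realDigamma_monotoneOn (mem_Ioi.2 h0)
    (mem_Ioi.2 (by linarith : 0 < x)) (by linarith)
  have h2 := realDigamma_monotoneOn (mem_Ioi.2 (by linarith : 0 < x))
    (mem_Ioi.2 (by linarith : 0 < x - 1/2 + 1)) (by linarith)
  rw [realDigamma_add_one h0] at h2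
  constructor <;> linarith

lemma tendsto_realDigamma_sub_half :
    Tendsto (fun x => realDigamma x - realDigamma (x - 1/2)) atTop (𝓝 0) := by
  have ht : Tendsto (fun x : ℝ => 1 / (x - 1/2)) atTop (𝓝 0) := by
    simp only [one_div]
    exact tendsto_inv_atTop_zero.comp (tendsto_atTop_add_const_right _ _ tendsto_id)
  refine tendsto_of_tendsto_of_tendsto_of_le_of_le' tendsto_const_nhds ht ?_ ?_ <;>
    filter_upwards [eventually_gt_atTop (1/2 : ℝ)] with x hx
  · exact (realDigamma_sub_half_bounds hx).1
  · exact (realDigamma_sub_half_bounds hx).2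

lemma tendsto_gammaPart : Tendsto gammaPart atTop (𝓝 0) := by
  have ha : Tendsto (fun x : ℝ => 1 + x/2) atTop atTop :=
    tendsto_atTop_add_const_left _ _ (tendsto_id.atTop_div_const (by norm_num))
  have h := tendsto_realDigamma_sub_half.sub
    ((tendsto_realDigamma_sub_half.comp ha).div_const 2)
  rw [zero_div, sub_zero] at h
  refine h.congr fun x => ?_
  simp only [Function.comp_apply, gammaPart]
  rw [show 1 + x/2 - 1/2 = 1/2 + x/2 by ring]

lemma gammaPart_sub_add_two {x : ℝ} (hx : 1 < x) :
    gammaPart x - gammaPart (x + 2) =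
      1 / (x - 1/2) + 1 / (x + 1/2) - 1/x - 2 / (x + 1) + 1 / (x + 2) := by
  have e1 : realDigamma (x + 2) = realDigamma x + 1/x + 1/(x + 1) := by
    rw [show x + 2 = (x + 1) + 1 by ring, realDigamma_add_one (by linarith),
      realDigamma_add_one (by linarith)]
  have e2 : realDigamma (x + 2 - 1/2) =
      realDigamma (x - 1/2) + 1/(x - 1/2) + 1/(x + 1/2) := by
    rw [show x + 2 - 1/2 = (x - 1/2 + 1) + 1 by ring, realDigamma_add_one (by linarith),
      realDigamma_add_one (by linarith), show x - 1/2 + 1 = x + 1/2 by ring]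
  have e3 : realDigamma (1 + (x + 2)/2) = realDigamma (1 + x/2) + 1/(1 + x/2) := by
    rw [show 1 + (x + 2)/2 = (1 + x/2) + 1 by ring, realDigamma_add_one (by linarith)]
  have e4 : realDigamma (1/2 + (x + 2)/2) = realDigamma (1/2 + x/2) + 1/(1/2 + x/2) := by
    rw [show 1/2 + (x + 2)/2 = (1/2 + x/2) + 1 by ring, realDigamma_add_one (by linarith)]
  have e5 : 1/(1 + x/2) = 2 / (x + 2) := by
    field_simp; ring
  have e6 : 1/(1/2 + x/2) = 2 / (x + 1) := by
    field_simp; ring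
  unfold gammaPart
  rw [e1, e2, e3, e4, e5, e6]
  ring

/-- A function vanishing at infinity whose steps of length two are decreasing is nonnegative. -/
lemma nonneg_of_tendsto_zero_of_step_two {D : ℝ → ℝ} (hD : Tendsto D atTop (𝓝 0)) {c : ℝ}
    (hstep : ∀ x, c < x → D (x + 2) ≤ D x) {x : ℝ} (hx : c < x) : 0 ≤ D x := by
  have hle : ∀ n : ℕ, D (x + 2 * n) ≤ D x := by
    intro n
    induction n with
    | zero => simp
    | succ k ih =>
      have hk : (0 : ℝ) ≤ k := k.cast_nonneg
      have := hstep (x + 2 * k) (by linarith)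
      rw [show x + 2 * ((k + 1 : ℕ) : ℝ) = x + 2 * k + 2 by push_cast; ring]
      linarith
  have ht : Tendsto (fun n : ℕ => x + 2 * (n : ℝ)) atTop atTop :=
    tendsto_atTop_add_const_left _ _
      (tendsto_natCast_atTop_atTop.const_mul_atTop (by norm_num))
  exact le_of_tendsto' (hD.comp ht) hle

/-- A function vanishing at infinity is monotone if its decrements over steps of length two are. -/
lemma le_of_tendsto_zero_of_step_two {D u : ℝ → ℝ} (hD : Tendsto D atTop (𝓝 0)) {c : ℝ}
    (hu : ∀ x, c < x → D x - D (x + 2) = u x) (hmono : MonotoneOn u (Ioi c))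
    {x y : ℝ} (hx : c < x) (hxy : x ≤ y) : D x ≤ D y := by
  have ht : Tendsto (fun z => D (z + (y - x)) - D z) atTop (𝓝 0) := by
    simpa using (hD.comp (tendsto_atTop_add_const_right _ (y - x) tendsto_id)).sub hD
  have h := nonneg_of_tendsto_zero_of_step_two ht (c := c) (fun z hz => ?_) hx
  · simp only [add_sub_cancel] at h
    linarith
  · have h1 := hu z hz
    have h2 := hu (z + (y - x)) (by linarith)
    have h3 := hmono (mem_Ioi.2 hz) (mem_Ioi.2 (by linarith : c < z + (y - x))) (by linarith)
    rw [show z + (y - x) + 2 = z + 2 + (y - x) by ring] at h2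
    linarith

lemma tendsto_const_div_pow_atTop (c : ℝ) {n : ℕ} (hn : n ≠ 0) :
    Tendsto (fun x : ℝ => c / x ^ n) atTop (𝓝 0) :=
  tendsto_const_nhds.div_atTop (tendsto_pow_atTop hn)

lemma gammaPart_lower_bound {x : ℝ} (hx : 1 < x) :
    5/8 / x^2 + 1/4 / x^3 ≤ gammaPart x := by
  have ht : Tendsto (fun x => gammaPart x - (5/8 / x^2 + 1/4 / x^3)) atTop (𝓝 0) := by
    simpa using tendsto_gammaPart.sub ((tendsto_const_div_pow_atTop (5/8) two_ne_zero).add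
      (tendsto_const_div_pow_atTop (1/4) three_ne_zero))
  have h := nonneg_of_tendsto_zero_of_step_two ht (c := 1) (fun z hz => ?_) hx
  · linarith
  · have h1 := gammaPart_sub_add_two hz
    obtain ⟨s, rfl⟩ : ∃ s, z = 1 + s := ⟨z - 1, by ring⟩
    have hs : 0 < s := by linarith
    have h2 : 1 / (1 + s - 1/2) + 1 / (1 + s + 1/2) - 1/(1 + s) - 2 / (1 + s + 1)
        + 1 / (1 + s + 2) - (5/8 / (1 + s)^2 + 1/4 / (1 + s)^3)
        + (5/8 / (1 + s + 2)^2 + 1/4 / (1 + s + 2)^3) =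
        (33/4 + 113/8 * s + 61/8 * s^2 + 11/8 * s^3 + 1/8 * s^4) /
          ((s + 1/2) * (s + 3/2) * (s + 1)^3 * (s + 2) * (s + 3)^3) := by
      rw [show 1 + s - 1/2 = s + 1/2 by ring, show 1 + s + 1/2 = s + 3/2 by ring,
        show 1 + s + 2 = s + 3 by ring, show 1 + s + 1 = s + 2 by ring, add_comm 1 s]
      field_simp
      ring
    have h3 : 0 ≤ (33/4 + 113/8 * s + 61/8 * s^2 + 11/8 * s^3 + 1/8 * s^4) /
          ((s + 1/2) * (s + 3/2) * (s + 1)^3 * (s + 2) * (s + 3)^3) := by positivity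
    linarith

/-- A rational approximation of `gammaPart`, accurate at infinity. -/
noncomputable def gammaApprox (x : ℝ) : ℝ :=
  5/8 / x^2 + 1/4 / x^3 + 1/16 / x^4 + 1/4 / x^6

lemma hasDerivAt_const_div_pow (c : ℝ) (n : ℕ) {x : ℝ} (hx : x ≠ 0) :
    HasDerivAt (fun y : ℝ => c / y ^ n) (-(c * n) / x ^ (n + 1)) x := by
  have h := ((hasDerivAt_pow n x).fun_inv (pow_ne_zero n hx)).const_mul c
  simp only [← div_eq_mul_inv] at h
  refine h.congr_deriv ?_
  rcases n with _ | n
  · simp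
  · simp only [Nat.add_sub_cancel]
    field_simp
    ring

lemma hasDerivAt_gammaApprox {x : ℝ} (hx : x ≠ 0) :
    HasDerivAt gammaApprox (-(5/4) / x^3 - 3/4 / x^4 - 1/4 / x^5 - 3/2 / x^7) x := by
  have h := (((hasDerivAt_const_div_pow (5/8) 2 hx).add
    (hasDerivAt_const_div_pow (1/4) 3 hx)).add (hasDerivAt_const_div_pow (1/16) 4 hx)).add
    (hasDerivAt_const_div_pow (1/4) 6 hx)
  refine h.congr_deriv ?_
  norm_num
  ring

lemma hasDerivAt_const_div_add (c a : ℝ) {x : ℝ} (hx : x + a ≠ 0) :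
    HasDerivAt (fun y : ℝ => c / (y + a)) (-c / (x + a)^2) x := by
  have h := (hasDerivAt_const_div_pow c 1 hx).comp_add_const x a
  simpa using h

lemma monotoneOn_gammaPart_step :
    MonotoneOn (fun x : ℝ => 1 / (x + -(1/2)) + 1 / (x + 1/2) - 1/(x + 0) - 2 / (x + 1)
      + 1 / (x + 2) - (gammaApprox x - gammaApprox (x + 2))) (Ioi 1) := by
  have hd : ∀ x ∈ Ioi (1 : ℝ), HasDerivAt (fun x : ℝ => 1 / (x + -(1/2)) + 1 / (x + 1/2)
      - 1/(x + 0) - 2 / (x + 1) + 1 / (x + 2) - (gammaApprox x - gammaApprox (x + 2)))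
      (-1 / (x + -(1/2))^2 + -1 / (x + 1/2)^2 - -1 / (x + 0)^2 - -2 / (x + 1)^2
        + -1 / (x + 2)^2 - ((-(5/4) / x^3 - 3/4 / x^4 - 1/4 / x^5 - 3/2 / x^7)
          - (-(5/4) / (x + 2)^3 - 3/4 / (x + 2)^4 - 1/4 / (x + 2)^5 - 3/2 / (x + 2)^7))) x := by
    intro x hx
    rw [mem_Ioi] at hx
    refine (((((hasDerivAt_const_div_add 1 (-(1/2)) (by linarith)).add
      (hasDerivAt_const_div_add 1 (1/2) (by linarith))).sub
      (hasDerivAt_const_div_add 1 0 (by linarith))).sub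
      (hasDerivAt_const_div_add 2 1 (by linarith))).add
      (hasDerivAt_const_div_add 1 2 (by linarith))).sub
      ((hasDerivAt_gammaApprox (by linarith)).sub
        ((hasDerivAt_gammaApprox (by linarith : x + 2 ≠ 0)).comp_add_const x 2))
  refine monotoneOn_of_deriv_nonneg (convex_Ioi 1)
    (fun x hx => (hd x hx).continuousAt.continuousWithinAt)
    (fun x hx => (hd x (interior_subset hx)).differentiableAt.differentiableWithinAt)
    (fun x hx => ?_)
  have hx1 := interior_subset hx
  rw [(hd x hx1).deriv]
  rw [mem_Ioi] at hx1
  obtain ⟨s, rfl⟩ : ∃ s, x = s + 1 := ⟨x - 1, by ring⟩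
  have hs : 0 < s := by linarith
  rw [show s + 1 + -(1/2) = s + 1/2 by ring, show s + 1 + 1/2 = s + 3/2 by ring,
    show s + 1 + 2 = s + 3 by ring, show s + 1 + 1 = s + 2 by ring, add_zero]
  have h2 : -1 / (s + 1/2)^2 + -1 / (s + 3/2)^2 - -1 / (s + 1)^2 - -2 / (s + 2)^2
        + -1 / (s + 3)^2 - ((-(5/4) / (s + 1)^3 - 3/4 / (s + 1)^4 - 1/4 / (s + 1)^5
          - 3/2 / (s + 1)^7)
          - (-(5/4) / (s + 3)^3 - 3/4 / (s + 3)^4 - 1/4 / (s + 3)^5 - 3/2 / (s + 3)^7)) =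
      (25083/8 + 56205/2 * s + 418431/4 * s ^ 2 + 1747341/8 * s ^ 3
        + 9391261/32 * s ^ 4 + 1115013/4 * s ^ 5 + 3266549/16 * s ^ 6 + 249705/2 * s ^ 7
        + 528007/8 * s ^ 8 + 58263/2 * s ^ 9 + 159945/16 * s ^ 10 + 19851/8 * s ^ 11
        + 13227/32 * s ^ 12 + 165/4 * s ^ 13 + 15/8 * s ^ 14) /
        ((s + 1/2)^2 * (s + 3/2)^2 * (s + 1)^7 * (s + 2)^2 * (s + 3)^7) := by
    field_simp
    ring
  rw [h2]
  positivity

lemma gammaPart_sub_gammaApprox_le {x y : ℝ} (hx : 1 < x) (hxy : x ≤ y) :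
    gammaPart x - gammaApprox x ≤ gammaPart y - gammaApprox y := by
  have ht : Tendsto (fun x => gammaPart x - gammaApprox x) atTop (𝓝 0) := by
    simpa [gammaApprox] using tendsto_gammaPart.sub
      ((((tendsto_const_div_pow_atTop (5/8) two_ne_zero).add
      (tendsto_const_div_pow_atTop (1/4) three_ne_zero)).add
      (tendsto_const_div_pow_atTop (1/16) four_ne_zero)).add
      (tendsto_const_div_pow_atTop (1/4) (n := 6) (by norm_num)))
  refine le_of_tendsto_zero_of_step_two ht (fun z hz => ?_) monotoneOn_gammaPart_step hx hxy
  have h1 := gammaPart_sub_add_two hz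
  rw [add_zero, ← sub_eq_add_neg]
  linarith

lemma hasDerivAt_log_one_sub_inv {x : ℝ} (hx : 1 < x) :
    HasDerivAt (fun y : ℝ => Real.log (1 - 1/y)) (1 / (x * (x - 1))) x := by
  have h0 : x ≠ 0 := by linarith
  have h1 : x - 1 ≠ 0 := by linarith
  have h2 : (1 : ℝ) - 1 / x ^ 1 ≠ 0 := by
    rw [pow_one, one_sub_div h0]
    exact div_ne_zero h1 h0
  have h := ((hasDerivAt_const_div_pow 1 1 h0).const_sub 1).log h2
  simp only [pow_one] at h
  refine h.congr_deriv ?_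
  rw [one_sub_div h0]
  norm_num
  field_simp

lemma log_one_sub_inv_lower_bound {x : ℝ} (hx : 2 < x) :
    -(1/x + 1/2/x^2 + 1/3/x^3 + 1/2/x^4) ≤ Real.log (1 - 1/x) := by
  set G : ℝ → ℝ := fun y =>
    Real.log (1 - 1/y) + (1/y^1 + 1/2/y^2 + 1/3/y^3 + 1/2/y^4) with hG
  have hd : ∀ y ∈ Ioi (2 : ℝ), HasDerivAt G (-(y - 2) / (y^5 * (y - 1))) y := by
    intro y hy
    rw [mem_Ioi] at hy
    have h0 : y ≠ 0 := by linarith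
    have h1 : y - 1 ≠ 0 := by linarith
    refine ((hasDerivAt_log_one_sub_inv (by linarith)).add
      ((((hasDerivAt_const_div_pow 1 1 h0).add (hasDerivAt_const_div_pow (1/2) 2 h0)).add
      (hasDerivAt_const_div_pow (1/3) 3 h0)).add
      (hasDerivAt_const_div_pow (1/2) 4 h0))).congr_deriv ?_
    norm_num
    field_simp
    ring
  have hanti : AntitoneOn G (Ioi 2) := by
    refine antitoneOn_of_deriv_nonpos (convex_Ioi 2)
      (fun x hx => (hd x hx).continuousAt.continuousWithinAt)
      (fun x hx => (hd x (interior_subset hx)).differentiableAt.differentiableWithinAt)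
      (fun y hy => ?_)
    have hy2 := interior_subset hy
    rw [(hd y hy2).deriv]
    rw [mem_Ioi] at hy2
    refine div_nonpos_of_nonpos_of_nonneg (by linarith) ?_
    have : 0 < y - 1 := by linarith
    positivity
  have ht : Tendsto G atTop (𝓝 0) := by
    have hl : Tendsto (fun y : ℝ => Real.log (1 - 1/y^1)) atTop (𝓝 0) := by
      have := ((tendsto_const_div_pow_atTop 1 one_ne_zero).const_sub 1).log
        (by norm_num)
      simpa using this
    have := hl.add ((((tendsto_const_div_pow_atTop 1 one_ne_zero).add
      (tendsto_const_div_pow_atTop (1/2) two_ne_zero)).add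
      (tendsto_const_div_pow_atTop (1/3) three_ne_zero)).add
      (tendsto_const_div_pow_atTop (1/2) four_ne_zero))
    simpa [hG] using this
  have h : 0 ≤ G x := by
    refine le_of_tendsto ht ?_
    filter_upwards [eventually_ge_atTop x] with y hy
    exact hanti hx (lt_of_lt_of_le hx hy) hy
  simp only [hG, pow_one] at h
  linarith

lemma logDerivPhi_pos_of_large {x : ℝ} (hx : 12/5 ≤ x) : 0 < logDerivPhi x := by
  have h1 := gammaPart_lower_bound (by linarith : 1 < x)
  have h2 := log_one_sub_inv_lower_bound (by linarith : 2 < x)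
  have h3 : 0 < (3*x^2 - 2*x - 12) / (24*x^4) := by
    apply div_pos
    · nlinarith
    · positivity
  have h4 : 5/8 / x^2 + 1/4 / x^3 - (1/2/x^2 + 1/3/x^3 + 1/2/x^4)
      = (3*x^2 - 2*x - 12) / (24*x^4) := by
    have : x ≠ 0 := by linarith
    field_simp
    ring
  unfold logDerivPhi
  linarith

lemma logDerivPhi_strictMonoOn : StrictMonoOn logDerivPhi (Ioc 1 (12/5)) := by
  have hd : ∀ x ∈ Ioc (1 : ℝ) (12/5), HasDerivAt
      (fun y => Real.log (1 - 1/y) + 1/y^1 + gammaApprox y)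
      ((x^5 - (x - 1) * (5/4*x^4 + 3/4*x^3 + 1/4*x^2 + 3/2)) / (x^7 * (x - 1))) x := by
    intro x hx
    have h0 : x ≠ 0 := by linarith [hx.1]
    have h1 : x - 1 ≠ 0 := by linarith [hx.1]
    refine (((hasDerivAt_log_one_sub_inv hx.1).add (hasDerivAt_const_div_pow 1 1 h0)).add
      (hasDerivAt_gammaApprox h0)).congr_deriv ?_
    norm_num
    field_simp
    ring
  have hm : StrictMonoOn (fun y => Real.log (1 - 1/y) + 1/y^1 + gammaApprox y)
      (Ioc 1 (12/5)) := by
    refine strictMonoOn_of_deriv_pos (convex_Ioc _ _)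
      (fun x hx => (hd x hx).continuousAt.continuousWithinAt) (fun x hx => ?_)
    have hx1 := interior_subset hx
    rw [(hd x hx1).deriv]
    obtain ⟨h1, h2⟩ := hx1
    have : 0 < x - 1 := by linarith
    refine div_pos ?_ (by positivity)
    have hq : 1/4 ≤ -x^2/4 + x/2 + 1/2 := by
      nlinarith [mul_nonneg (sub_nonneg.2 h1.le) (sub_nonneg.2 h2)]
    have hr : 0 < x^3/4 + x^2/4 - 3/2*x + 3/2 := by
      nlinarith [mul_nonneg this.le (sq_nonneg (x - 1)), sq_nonneg (x - 9/8)]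
    have hx3 : 0 < x^3 := by positivity
    linarith [mul_le_mul_of_nonneg_left hq hx3.le]
  intro x hx y hy hxy
  have h1 := hm hx hy hxy
  have h2 := gammaPart_sub_gammaApprox_le hx.1 hxy.le
  simp only [pow_one] at h1
  unfold logDerivPhi
  linarith

lemma logDerivPhi_two : logDerivPhi 2 = 0 := by
  have h1 : realDigamma 2 = 1 - Real.eulerMascheroniConstant := by
    rw [show (2 : ℝ) = 1 + 1 by norm_num, realDigamma_add_one one_pos, realDigamma_one]
    ring
  have h2 : realDigamma (3/2) = 2 - (Real.eulerMascheroniConstant + 2 * Real.log 2) := by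
    rw [show (3/2 : ℝ) = 1/2 + 1 by norm_num, realDigamma_add_one (by norm_num),
      realDigamma_one_half]
    ring
  unfold logDerivPhi gammaPart
  rw [show (2 : ℝ) - 1/2 = 3/2 by norm_num, show (1 : ℝ) + 2/2 = 2 by norm_num,
    show (1/2 : ℝ) + 2/2 = 3/2 by norm_num, h1, h2, show (1 : ℝ) - 1/2 = 2⁻¹ by norm_num,
    Real.log_inv]
  ring

lemma logDerivPhi_pos {x : ℝ} (hx : 2 < x) : 0 < logDerivPhi x := by
  rcases le_total (12/5) x with h | h
  · exact logDerivPhi_pos_of_large h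
  · rw [← logDerivPhi_two]
    exact logDerivPhi_strictMonoOn ⟨by norm_num, by norm_num⟩ ⟨by linarith, h⟩ hx

lemma logDerivPhi_neg {x : ℝ} (h1 : 1 < x) (h2 : x < 2) : logDerivPhi x < 0 := by
  rw [← logDerivPhi_two]
  exact logDerivPhi_strictMonoOn ⟨h1, by linarith⟩ ⟨by norm_num, by norm_num⟩ h2

lemma one_sub_inv_pos {x : ℝ} (hx : 1 < x) : 0 < 1 - 1/x := by
  rw [sub_pos, div_lt_one (by linarith)]
  exact hx

lemma Phi_pos {x : ℝ} (hx : 1 < x) : 0 < Phi x := by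
  have h1 := Real.rpow_pos_of_pos (one_sub_inv_pos hx) (x - 1)
  have h2 := Real.Gamma_pos_of_pos (by linarith : 0 < 1/2 + x/2)
  have h3 := Real.Gamma_pos_of_pos (by linarith : 0 < x)
  have h4 := Real.Gamma_pos_of_pos (by linarith : 0 < 1 + x/2)
  have h5 := Real.Gamma_pos_of_pos (by linarith : 0 < -1/2 + x)
  unfold Phi
  positivity

lemma hasDerivAt_Phi {x : ℝ} (hx : 1 < x) : HasDerivAt Phi (Phi x * logDerivPhi x) x := by
  have h0 : x ≠ 0 := by linarith
  have h1 : x - 1 ≠ 0 := by linarith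
  have hp := one_sub_inv_pos hx
  have dhalf : HasDerivAt (fun y : ℝ => y/2) (1/2) x := (hasDerivAt_id x).div_const 2
  have hP : HasDerivAt (fun y : ℝ => (1 - 1/y) ^ (y - 1))
      ((1 - 1/x) ^ (x - 1) * (Real.log (1 - 1/x) + 1/x)) x := by
    have he : (fun y : ℝ => (1 - 1/y) ^ (y - 1)) =ᶠ[𝓝 x]
        fun y => Real.exp (Real.log (1 - 1/y) * (y - 1)) := by
      filter_upwards [lt_mem_nhds hx] with y hy
      exact Real.rpow_def_of_pos (one_sub_inv_pos hy) _
    have := ((hasDerivAt_log_one_sub_inv hx).mul ((hasDerivAt_id x).sub_const 1)).exp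
    refine (this.congr_of_eventuallyEq he).congr_deriv ?_
    simp only [Pi.mul_apply, id]
    rw [Real.rpow_def_of_pos hp]
    field_simp
    ring
  have g1 : HasDerivAt (fun y : ℝ => Real.Gamma (1/2 + y/2)) _ x :=
    (hasDerivAt_Gamma_realDigamma (by linarith : 0 < 1/2 + x/2)).comp x
      (h₂ := Real.Gamma) (h := fun y : ℝ => 1/2 + y/2) (dhalf.const_add (1/2))
  have g2 := hasDerivAt_Gamma_realDigamma (by linarith : 0 < x)
  have g3 : HasDerivAt (fun y : ℝ => Real.Gamma (1 + y/2)) _ x :=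
    (hasDerivAt_Gamma_realDigamma (by linarith : 0 < 1 + x/2)).comp x
      (h₂ := Real.Gamma) (h := fun y : ℝ => 1 + y/2) (dhalf.const_add 1)
  have g4 : HasDerivAt (fun y : ℝ => Real.Gamma (-1/2 + y)) _ x :=
    (hasDerivAt_Gamma_realDigamma (by linarith : 0 < -1/2 + x)).comp_const_add (-1/2) x
  have h3 := (Real.Gamma_pos_of_pos (by linarith : 0 < 1 + x/2)).ne'
  have h4 := (Real.Gamma_pos_of_pos (by linarith : 0 < -1/2 + x)).ne'
  refine (((hP.const_mul 2).mul (g1.mul g2)).div (g3.mul g4) (mul_ne_zero h3 h4)).congr_deriv ?_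
  simp only [Pi.mul_apply]
  unfold Phi logDerivPhi gammaPart
  rw [show x - 1/2 = -1/2 + x by ring]
  generalize (1 - 1/x) ^ (x - 1) = P
  generalize Real.log (1 - 1/x) = L
  field_simp
  ring

theorem stmt_8 :
    (∀ x : ℝ, 2 < x → deriv Phi x > 0) ∧
    (∀ x : ℝ, 1 < x → x < 2 → deriv Phi x < 0) ∧
    StrictAntiOn Phi (Set.Ioo 1 2) ∧
    StrictMonoOn Phi (Set.Ioi 2) := by
  have hpos : ∀ x : ℝ, 2 < x → deriv Phi x > 0 := fun x hx => by
    rw [(hasDerivAt_Phi (by linarith)).deriv]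
    exact mul_pos (Phi_pos (by linarith)) (logDerivPhi_pos hx)
  have hneg : ∀ x : ℝ, 1 < x → x < 2 → deriv Phi x < 0 := fun x h1 h2 => by
    rw [(hasDerivAt_Phi h1).deriv]
    exact mul_neg_of_pos_of_neg (Phi_pos h1) (logDerivPhi_neg h1 h2)
  refine ⟨hpos, hneg, ?_, ?_⟩
  · refine strictAntiOn_of_deriv_neg (convex_Ioo 1 2)
      (fun x hx => (hasDerivAt_Phi hx.1).continuousAt.continuousWithinAt) fun x hx => ?_
    have h := interior_subset hx
    exact hneg x h.1 h.2
  · refine strictMonoOn_of_deriv_pos (convex_Ioi 2)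
      (fun x hx => (hasDerivAt_Phi (one_lt_two.trans hx)).continuousAt.continuousWithinAt)
      fun x hx => ?_
    exact hpos x (interior_subset hx)
end

section
/- Let Φ(x) = 2(1 − 1/x)^{x−1} Γ(1/2 + x/2) Γ(x) / (Γ(1 + x/2) Γ(−1/2 + x)) for real x > 1. Then lim_{x → ∞} log Φ(x) = (3/2) log 2 − 1; equivalently, Φ(x) tends to 2√2 / e as x → ∞. -/
open Filter

/-- The ratio `Γ(s + 1/2) / (Γ(s) √s)`. -/
noncomputable def gammaHalfRatio (s : ℝ) : ℝ :=
  Real.Gamma (s + 1/2) / (Real.Gamma s * Real.sqrt s)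

theorem Gamma_add_half_le {s : ℝ} (hs : 0 < s) :
    Real.Gamma (s + 1/2) ≤ Real.Gamma s * Real.sqrt s := by
  have h := Real.Gamma_mul_add_mul_le_rpow_Gamma_mul_rpow_Gamma hs
    (by linarith : (0:ℝ) < s + 1) (by norm_num : (0:ℝ) < 1/2) (by norm_num : (0:ℝ) < 1/2)
    (by norm_num)
  have hG := Real.Gamma_pos_of_pos hs
  rw [Real.Gamma_add_one hs.ne', Real.mul_rpow hs.le hG.le, ← Real.sqrt_eq_rpow,
    ← Real.sqrt_eq_rpow, show 1 / 2 * s + 1 / 2 * (s + 1) = s + 1 / 2 by ring] at h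
  calc Real.Gamma (s + 1/2) ≤ _ := h
    _ = (√(Real.Gamma s) * √(Real.Gamma s)) * √s := by ring
    _ = _ := by rw [Real.mul_self_sqrt hG.le]

theorem gammaHalfRatio_le_one {s : ℝ} (hs : 0 < s) : gammaHalfRatio s ≤ 1 := by
  have hG := Real.Gamma_pos_of_pos hs
  exact div_le_one_of_le₀ (Gamma_add_half_le hs) (by positivity)

theorem sqrt_div_add_half_le_gammaHalfRatio {s : ℝ} (hs : 0 < s) :
    Real.sqrt (s / (s + 1/2)) ≤ gammaHalfRatio s := by
  have hG := Real.Gamma_pos_of_pos hs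
  have h := Gamma_add_half_le (by linarith : (0:ℝ) < s + 1/2)
  rw [show s + 1/2 + 1/2 = s + 1 by ring, Real.Gamma_add_one hs.ne'] at h
  have hr : 0 < √(s + 1/2) := Real.sqrt_pos.mpr (by linarith)
  rw [Real.sqrt_div hs.le, gammaHalfRatio, div_le_div_iff₀ hr (by positivity)]
  calc √s * (Real.Gamma s * √s) = (√s * √s) * Real.Gamma s := by ring
    _ = s * Real.Gamma s := by rw [Real.mul_self_sqrt hs.le]
    _ ≤ _ := h

theorem tendsto_const_div_linear (a b : ℝ) {c : ℝ} (hc : 0 < c) :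
    Tendsto (fun x : ℝ => a / (b + c * x)) atTop (nhds 0) :=
  Tendsto.const_div_atTop (tendsto_atTop_add_const_left _ b (tendsto_id.const_mul_atTop hc)) a

theorem tendsto_gammaHalfRatio : Tendsto gammaHalfRatio atTop (nhds 1) := by
  have h : Tendsto (fun s : ℝ => Real.sqrt (s / (s + 1/2))) atTop (nhds 1) := by
    have h1 := ((tendsto_const_div_linear (1/2) (1/2) one_pos).const_sub 1).sqrt
    rw [sub_zero, Real.sqrt_one] at h1
    refine h1.congr' ?_
    filter_upwards [eventually_gt_atTop 0] with s hs
    congr 1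
    have : 1/2 + 1 * s ≠ 0 := by positivity
    have : s + 1/2 ≠ 0 := by positivity
    field_simp
    ring
  refine tendsto_of_tendsto_of_tendsto_of_le_of_le' h tendsto_const_nhds ?_ ?_
  · filter_upwards [eventually_gt_atTop 0] with s hs
    exact sqrt_div_add_half_le_gammaHalfRatio hs
  · filter_upwards [eventually_gt_atTop 0] with s hs
    exact gammaHalfRatio_le_one hs

theorem tendsto_one_sub_inv_rpow :
    Tendsto (fun x : ℝ => (1 - 1 / x) ^ (x - 1)) atTop (nhds (Real.exp (-1))) := by
  have h1 := Real.tendsto_one_add_div_rpow_exp (-1)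
  have h2 : Tendsto (fun x : ℝ => 1 - 1 / x) atTop (nhds 1) := by
    simpa using (tendsto_const_div_linear 1 0 one_pos).const_sub 1
  have h3 := h1.div h2 one_ne_zero
  rw [div_one] at h3
  refine h3.congr' ?_
  filter_upwards [eventually_gt_atTop 1] with x hx
  have hpos : 0 < 1 - 1 / x := by
    rw [sub_pos, div_lt_one (by linarith)]
    exact hx
  rw [Real.rpow_sub_one hpos.ne', Pi.div_apply, neg_div, ← sub_eq_add_neg]

theorem Phi_eq_gammaHalfRatio {x : ℝ} (hx : 1 < x) :
    Phi x = 2 * (1 - 1 / x) ^ (x - 1) *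
      (gammaHalfRatio (x - 1/2) / gammaHalfRatio (1/2 + x/2)) *
        Real.sqrt ((x - 1/2) / (1/2 + x/2)) := by
  have h1 : 0 < x - 1/2 := by linarith
  have h2 : 0 < 1/2 + x/2 := by linarith
  have g1 := Real.Gamma_pos_of_pos h1
  have g2 := Real.Gamma_pos_of_pos h2
  have g3 : 0 < Real.Gamma (1 + x/2) := Real.Gamma_pos_of_pos (by linarith)
  have r1 := Real.sqrt_pos.mpr h1
  have r2 := Real.sqrt_pos.mpr h2
  rw [Real.sqrt_div h1.le, Phi, gammaHalfRatio, gammaHalfRatio,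
    show x - 1/2 + 1/2 = x by ring, show 1/2 + x/2 + 1/2 = 1 + x/2 by ring,
    show -1/2 + x = x - 1/2 by ring]
  generalize (1 - 1 / x) ^ (x - 1) = A
  generalize Real.Gamma (x - 1/2) = a at *
  generalize Real.Gamma (1/2 + x/2) = b at *
  generalize Real.Gamma (1 + x/2) = c at *
  generalize √(x - 1/2) = d at *
  generalize √(1/2 + x/2) = e at *
  field_simp

theorem tendsto_Phi : Tendsto Phi atTop (nhds (2 * Real.sqrt 2 / Real.exp 1)) := by
  have hu : Tendsto (fun x : ℝ => x - 1/2) atTop atTop :=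
    tendsto_atTop_add_const_right _ _ tendsto_id
  have hv : Tendsto (fun x : ℝ => 1/2 + x/2) atTop atTop :=
    tendsto_atTop_add_const_left _ _ (tendsto_id.atTop_div_const two_pos)
  have hs : Tendsto (fun x : ℝ => Real.sqrt ((x - 1/2) / (1/2 + x/2))) atTop
      (nhds (Real.sqrt 2)) := by
    have h := ((tendsto_const_div_linear (3/2) (1/2) (half_pos one_pos)).const_sub 2).sqrt
    rw [sub_zero] at h
    refine h.congr' ?_
    filter_upwards [eventually_gt_atTop 0] with x hx
    congr 1
    have h1 : 1/2 + 1/2 * x ≠ 0 := by positivity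
    rw [show 1/2 + x/2 = 1/2 + 1/2 * x by ring, eq_div_iff h1, sub_mul, div_mul_cancel₀ _ h1]
    ring
  have h := ((tendsto_one_sub_inv_rpow.const_mul 2).mul
    ((tendsto_gammaHalfRatio.comp hu).div (tendsto_gammaHalfRatio.comp hv) one_ne_zero)).mul hs
  rw [show 2 * Real.exp (-1) * (1 / 1) * √2 = 2 * √2 / Real.exp 1 by
    rw [Real.exp_neg]; ring] at h
  refine h.congr' ?_
  filter_upwards [eventually_gt_atTop 1] with x hx
  exact (Phi_eq_gammaHalfRatio hx).symm

theorem stmt_14 :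
    Tendsto (fun x : ℝ => Real.log (Phi x)) atTop (nhds ((3/2) * Real.log 2 - 1)) ∧
    Tendsto Phi atTop (nhds (2 * Real.sqrt 2 / Real.exp 1)) := by
  refine ⟨?_, tendsto_Phi⟩
  have h := tendsto_Phi.log (by positivity)
  rw [Real.log_div (by positivity) (by positivity), Real.log_mul (by positivity) (by positivity),
    Real.log_sqrt (by norm_num), Real.log_exp,
    show Real.log 2 + Real.log 2 / 2 - 1 = (3/2) * Real.log 2 - 1 by ring] at h
  exact h
end

section
/- Let 1 < p < ∞, set a = 2(p − 1)/p, and let Φ(x) = 2(1 − 1/x)^{x−1} Γ(1/2 + x/2) Γ(x) / (Γ(1 + x/2) Γ(−1/2 + x)) for x > 1. Then ∫_ℝ ((a − 1)² + a² x²)^{p/2} (1 + x²)^{−p} dx ≥ Φ(p) ∫_ℝ (1 + x²)^{−p} dx, with equality if and only if p = 2. (The left-hand side is the p-th power of the H^p(ℂ₊)-norm of V(p)h and the integral on the right is the p-th power of the norm of the test function h(z) = (i + z)^{−2}, where V(p) = 2((p−1)/p)C − I and C is the Cesàro operator Cf(z) = (1/z)∫₀^z f(ζ) dζ; on the boundary,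 (V(p)h)(x) = (a(1 − ix) − 1)/(i + x)², which gives the stated integrals.) -/
open MeasureTheory Set ProbabilityTheory

theorem integral_Ioo_rpow_mul_one_sub_rpow {u v : ℝ} (hu : 0 < u) (hv : 0 < v) :
    ∫ t in Ioo (0 : ℝ) 1, t ^ (u - 1) * (1 - t) ^ (v - 1) = beta u v := by
  rw [beta_eq_betaIntegralReal u v hu hv, Complex.betaIntegral,
    intervalIntegral.integral_of_le (by norm_num), ← integral_Ioc_eq_integral_Ioo,
    ← RCLike.re_to_complex, ← integral_re]
  · refine setIntegral_congr_fun measurableSet_Ioc fun x ⟨hx1, hx2⟩ ↦ ?_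
    norm_cast
    rw [← Complex.ofReal_cpow, ← Complex.ofReal_cpow, RCLike.re_to_complex,
      Complex.re_mul_ofReal, Complex.ofReal_re]
    all_goals linarith
  · convert! Complex.betaIntegral_convergent (u := u) (v := v) (by simpa) (by simpa)
    rw [intervalIntegrable_iff_integrableOn_Ioc_of_le (by simp), IntegrableOn]

theorem image_div_one_add_Ioi : (fun y : ℝ ↦ y / (1 + y)) '' Ioi 0 = Ioo 0 1 := by
  ext t
  constructor
  · rintro ⟨y, hy, rfl⟩
    have hy : 0 < y := hy
    exact ⟨by positivity, by rw [div_lt_one (by positivity)]; linarith⟩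
  · rintro ⟨h0, h1⟩
    have h : 0 < 1 - t := by linarith
    refine ⟨t / (1 - t), div_pos h0 h, ?_⟩
    field_simp
    ring

theorem integral_Ioi_rpow_mul_one_add_rpow {u v : ℝ} (hu : 0 < u) (hv : 0 < v) :
    ∫ y in Ioi (0 : ℝ), y ^ (u - 1) * (1 + y) ^ (-(u + v)) = beta u v := by
  rw [← integral_Ioo_rpow_mul_one_sub_rpow hu hv, ← image_div_one_add_Ioi,
    integral_image_eq_integral_abs_deriv_smul (f' := fun y ↦ 1 / (1 + y) ^ 2) measurableSet_Ioi]
  · refine setIntegral_congr_fun measurableSet_Ioi fun y (hy : 0 < y) ↦ ?_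
    have h : 0 < 1 + y := by linarith
    have h1 : 1 - y / (1 + y) = (1 + y)⁻¹ := by field_simp; ring
    simp only [smul_eq_mul]
    rw [h1, abs_of_pos (by positivity), Real.div_rpow hy.le h.le, Real.inv_rpow h.le,
      ← Real.rpow_natCast, one_div, div_eq_mul_inv, ← Real.rpow_neg h.le, ← Real.rpow_neg h.le,
      ← Real.rpow_neg h.le]
    have h2 : -(u + v) = -((2 : ℕ) : ℝ) + (-(u - 1) + -(v - 1)) := by push_cast; ring
    rw [h2, Real.rpow_add h, Real.rpow_add h]
    ring
  · intro y (hy : 0 < y)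
    have h : 1 + y ≠ 0 := by linarith
    have := ((hasDerivAt_id y).div ((hasDerivAt_id y).const_add 1) h).hasDerivWithinAt
      (s := Ioi 0)
    convert! this using 1
    simp
  · intro x (hx : 0 < x) y (hy : 0 < y) hxy
    simp only at hxy
    rw [div_eq_div_iff (by positivity) (by positivity)] at hxy
    linarith

theorem integral_abs_rpow_mul_one_add_sq_rpow {q p : ℝ} (hq : -1 < q) (hp : q + 1 < 2 * p) :
    ∫ x : ℝ, |x| ^ q * (1 + x ^ 2) ^ (-p) = beta ((q + 1) / 2) (p - (q + 1) / 2) := by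
  rw [← integral_Ioi_rpow_mul_one_add_rpow (by linarith) (by linarith),
    ← integral_comp_rpow_Ioi_of_pos (p := 2) two_pos]
  have h := integral_comp_abs (f := fun x : ℝ ↦ x ^ q * (1 + x ^ 2) ^ (-p))
  simp only [sq_abs] at h
  rw [h, ← integral_const_mul]
  refine setIntegral_congr_fun measurableSet_Ioi fun x (hx : 0 < x) ↦ ?_
  have h1 : q = (2 - 1) + 2 * ((q + 1) / 2 - 1) := by ring
  simp only [smul_eq_mul]
  rw [← Real.rpow_mul hx.le]
  conv_lhs => rw [h1, Real.rpow_add hx]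
  rw [Real.rpow_two, add_sub_cancel]
  ring

theorem Phi_mul_integral {p : ℝ} (hp : 1 < p) :
    Phi p * ∫ x : ℝ, (1 + x ^ 2) ^ (-p) =
      (2 * (p - 1) / p) ^ p * ∫ x : ℝ, |x| ^ p * (1 + x ^ 2) ^ (-p) := by
  have h0 := integral_abs_rpow_mul_one_add_sq_rpow (q := 0) (p := p) (by norm_num) (by linarith)
  simp only [Real.rpow_zero, one_mul, zero_add] at h0
  rw [h0, integral_abs_rpow_mul_one_add_sq_rpow (by linarith) (by linarith), beta, beta, Phi]
  have e1 : (1 : ℝ) / 2 + (p - 1 / 2) = p := by ring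
  have e2 : (p + 1) / 2 + (p - (p + 1) / 2) = p := by ring
  have e3 : p - (p + 1) / 2 = (p - 1) / 2 := by ring
  have e4 : (1 : ℝ) / 2 + p / 2 = (p - 1) / 2 + 1 := by ring
  have e5 : (p + 1) / 2 = (p - 1) / 2 + 1 := by ring
  have e6 : -1 / 2 + p = p - 1 / 2 := by ring
  have e7 : 1 + p / 2 = p / 2 + 1 := by ring
  have hm : 0 < (p - 1) / 2 := by linarith
  have hh : 0 < p / 2 := by linarith
  have hq : 0 < 1 - 1 / p := by rw [sub_pos, div_lt_one (by linarith)]; exact hp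
  have hdup := Real.Gamma_mul_Gamma_add_half (p / 2)
  rw [show p / 2 + 1 / 2 = (p - 1) / 2 + 1 by ring, show 2 * (p / 2) = p by ring,
    Real.Gamma_add_one hm.ne', Real.rpow_sub two_pos, Real.rpow_one] at hdup
  have hpow : (2 * (p - 1) / p) ^ p = 2 ^ p * ((1 - 1 / p) ^ (p - 1) * ((p - 1) / p)) := by
    have : 2 * (p - 1) / p = 2 * (1 - 1 / p) := by field_simp
    rw [this, Real.mul_rpow two_pos.le hq.le]
    have h1 := Real.rpow_add_one hq.ne' (p - 1)
    rw [sub_add_cancel] at h1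
    rw [h1, one_sub_div (by positivity)]
  rw [hpow, e1, e2, e3, e4, e5, e6, e7, Real.Gamma_add_one hm.ne', Real.Gamma_add_one hh.ne',
    Real.Gamma_one_half_eq]
  have hG := Real.Gamma_pos_of_pos (show 0 < p - 1 / 2 by linarith)
  generalize Real.Gamma (p - 1 / 2) = G at hG ⊢
  generalize (1 - 1 / p) ^ (p - 1) = Q
  field_simp at hdup ⊢
  linear_combination -(p - 1) * Q * hdup

theorem integrable_rpow_mul_one_add_sq_rpow {p b c : ℝ} (hp : 1 < p) (hb : 0 ≤ b) (hc : 0 ≤ c) :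
    Integrable fun x : ℝ ↦ (b + c * x ^ 2) ^ (p / 2) * (1 + x ^ 2) ^ (-p) := by
  have h := (integrable_rpow_neg_one_add_norm_sq (E := ℝ) (μ := volume) (r := p)
    (by simpa using hp)).const_mul ((b + c) ^ (p / 2))
  refine h.mono' (Measurable.aestronglyMeasurable (by fun_prop)) (.of_forall fun x ↦ ?_)
  have hx : 0 < 1 + x ^ 2 := by positivity
  rw [Real.norm_of_nonneg (by positivity), Real.norm_eq_abs, sq_abs, neg_div]
  calc (b + c * x ^ 2) ^ (p / 2) * (1 + x ^ 2) ^ (-p)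
      ≤ ((b + c) * (1 + x ^ 2)) ^ (p / 2) * (1 + x ^ 2) ^ (-p) := by
        gcongr
        nlinarith [mul_nonneg hb (sq_nonneg x)]
    _ = (b + c) ^ (p / 2) * (1 + x ^ 2) ^ (-(p / 2)) := by
        rw [Real.mul_rpow (by positivity) hx.le, mul_assoc, ← Real.rpow_add hx]
        ring_nf

theorem stmt_17 (p : ℝ) (hp : 1 < p) (a : ℝ) (ha : a = 2 * (p - 1) / p) :
    (∫ x : ℝ, ((a - 1) ^ 2 + a ^ 2 * x ^ 2) ^ (p / 2) * (1 + x ^ 2) ^ (-p)) ≥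
      Phi p * ∫ x : ℝ, (1 + x ^ 2) ^ (-p) ∧
    ((∫ x : ℝ, ((a - 1) ^ 2 + a ^ 2 * x ^ 2) ^ (p / 2) * (1 + x ^ 2) ^ (-p)) =
      Phi p * (∫ x : ℝ, (1 + x ^ 2) ^ (-p)) ↔ p = 2) := by
  have ha0 : 0 < a := by rw [ha]; exact div_pos (by linarith) (by linarith)
  have hRHS : Phi p * ∫ x : ℝ, (1 + x ^ 2) ^ (-p) =
      ∫ x : ℝ, (0 + a ^ 2 * x ^ 2) ^ (p / 2) * (1 + x ^ 2) ^ (-p) := by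
    rw [Phi_mul_integral hp, ← ha, ← integral_const_mul]
    congr 1 with x
    have h : 0 + a ^ 2 * x ^ 2 = (a * |x|) ^ (2 : ℝ) := by
      rw [Real.rpow_two, mul_pow, sq_abs, zero_add]
    rw [h, ← Real.rpow_mul (by positivity), mul_div_cancel₀ p two_ne_zero,
      Real.mul_rpow ha0.le (abs_nonneg x), mul_assoc]
  have hi1 := integrable_rpow_mul_one_add_sq_rpow hp (sq_nonneg (a - 1)) (sq_nonneg a)
  have hi0 := integrable_rpow_mul_one_add_sq_rpow hp le_rfl (sq_nonneg a)
  have hle (x : ℝ) : (0 + a ^ 2 * x ^ 2) ^ (p / 2) * (1 + x ^ 2) ^ (-p) ≤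
      ((a - 1) ^ 2 + a ^ 2 * x ^ 2) ^ (p / 2) * (1 + x ^ 2) ^ (-p) := by
    gcongr
    exact sq_nonneg _
  rw [hRHS]
  refine ⟨integral_mono hi0 hi1 hle, fun heq ↦ ?_, fun h ↦ ?_⟩
  · obtain ⟨x, hx⟩ := ((integral_eq_iff_of_ae_le hi0 hi1 (.of_forall hle)).1 heq.symm).exists
    have hpos : (1 + x ^ 2) ^ (-p) ≠ 0 := by positivity
    have h1 := (Real.rpow_left_inj (by positivity) (by positivity) (by positivity)).1
      (mul_right_cancel₀ hpos hx)
    have h2 : a = 1 := by nlinarith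
    rw [h2, eq_div_iff (by positivity)] at ha
    linarith
  · have h2 : a = 1 := by rw [ha, h]; norm_num
    rw [h2, sub_self, zero_pow two_ne_zero]
end
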